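/- For every n ≥ 1 and every m ∈ {2, …, n+1}, there is an n-regular acyclic Borel graph G on a standard Borel space with Borel chromatic number χ_B(G) = m. -/

import Mathlib

/-- The left shift action of a group `G` on the product space `G → X`:
`(γ • y) β = y (γ⁻¹ * β)`. -/
def shift {G : Type*} [Group G] {X : Type*} (γ : G) (y : G → X) : G → X :=
  fun β => y (γ⁻¹ * β)

/-- The free part `Free(X^G)` of the left shift action of `G` on `G → X`. -/
def freePart (G : Type*) [Group G] (X : Type*) : Set (G → X) :=
  {y | ∀ γ : G, γ ≠ 1 → shift γ y ≠ y}

/-- The Borel chromatic number of a (graph given by a) relation `G` on a measurable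
space `X`: the least cardinality of a standard Borel space `Y` admitting a Borel
(measurable) coloring `c : X → Y` with `c x ≠ c y` whenever `G x y`. -/
noncomputable def borelChromaticNumber {X : Type} [mX : MeasurableSpace X]
    (G : X → X → Prop) : Cardinal :=
  sInf {κ : Cardinal | ∃ (Y : Type) (mY : MeasurableSpace Y),
    @StandardBorelSpace Y mY ∧ Cardinal.mk Y = κ ∧
    ∃ c : X → Y, @Measurable X Y mX mY c ∧ ∀ x y, G x y → c x ≠ c y}

/-- The adjacency relation of the graph `G(Γ, X)` on the free part `Free(X^Γ)` determined
by a set `S` of generators of `Γ`: `x` and `y` are adjacent iff some `γ ∈ S` shifts `x`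
to `y` or `y` to `x`. -/
def cayleyAdj {Γ : Type} [Group Γ] (S : Set Γ) (X : Type) :
    ↥(freePart Γ X) → ↥(freePart Γ X) → Prop :=
  fun x y => ∃ γ ∈ S,
    shift γ (x : Γ → X) = (y : Γ → X) ∨ shift γ (y : Γ → X) = (x : Γ → X)

/-! ### Inverse sequences -/

/-- In an inverse sequence of types whose bonding maps are surjective from index `i` on, every
element at index `i` belongs to a thread. -/
theorem exists_thread {P : ℕ → Type} (π : ∀ n, P (n + 1) → P n) (i : ℕ)
    (hπ : ∀ n, i ≤ n → Function.Surjective (π n)) (q : P i) :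
    ∃ f : ∀ n, P n, f i = q ∧ ∀ n, π n (f (n + 1)) = f n := by
  have hdown : ∀ (i : ℕ) (q : P i), ∃ f : ∀ n, n ≤ i → P n, f i le_rfl = q ∧
      ∀ n (h : n + 1 ≤ i), π n (f (n + 1) h) = f n (Nat.le_of_succ_le h) := by
    intro i
    induction i with
    | zero =>
      intro q
      refine ⟨fun n h => (Nat.le_zero.1 h) ▸ q, rfl, fun n h => absurd h (by omega)⟩
    | succ i ih =>
      intro q
      obtain ⟨f, hf, hf'⟩ := ih (π i q)
      refine ⟨fun n h => if h' : n = i + 1 then h' ▸ q else f n (by omega), by simp, ?_⟩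
      intro n h
      rcases Nat.lt_or_ge n i with h' | h'
      · have h1 : n ≠ i := by omega
        have h2 : n ≠ i + 1 := by omega
        simp only [Nat.add_right_cancel_iff, h1, h2, dite_false]
        exact hf' n (by omega)
      · obtain rfl : n = i := by omega
        simp [hf]
  obtain ⟨f, hf, hf'⟩ := hdown i q
  let g : ∀ n, P n := fun n => Nat.rec (motive := P) (f 0 (Nat.zero_le _))
    (fun n r => if h : n + 1 ≤ i then f (n + 1) h else
      Function.surjInv (hπ n (by omega)) r) n
  have hg : ∀ n (h : n ≤ i), g n = f n h := by
    intro n h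
    cases n with
    | zero => rfl
    | succ n => exact dif_pos h
  refine ⟨g, (hg i le_rfl).trans hf, fun n => ?_⟩
  by_cases h : n + 1 ≤ i
  · rw [hg _ h, hf' n h, hg]
  · have : g (n + 1) = Function.surjInv (hπ n (by omega)) (g n) := dif_neg h
    rw [this]
    exact Function.surjInv_eq _ _

theorem thread_eq_of_le {P : ℕ → Type} {π : ∀ n, P (n + 1) → P n} {f g : ∀ n, P n}
    (hf : ∀ n, π n (f (n + 1)) = f n) (hg : ∀ n, π n (g (n + 1)) = g n) {m n : ℕ} (hmn : m ≤ n)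
    (h : f n = g n) : f m = g m := by
  induction n, hmn using Nat.le_induction with
  | base => exact h
  | succ n _ ih => exact ih (by rw [← hf, ← hg, h])

/-! ### Game trees -/

/-- A pruned game tree, given by its positions at every level. -/
structure GameTree where
  Pos : ℕ → Type
  pred : ∀ n, Pos (n + 1) → Pos n
  pred_surj : ∀ n, Function.Surjective (pred n)

namespace GameTree

/-- An infinite play: a branch of the game tree. -/
structure Play (T : GameTree) where
  pos : ∀ n, T.Pos n
  pred_pos : ∀ n, T.pred n (pos (n + 1)) = pos n

/-- A choice of a next position at every position. Player `j` uses it at the levels congruent to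
`j` modulo `2`. -/
structure Strategy (T : GameTree) where
  move : ∀ n, T.Pos n → T.Pos (n + 1)
  pred_move : ∀ n p, T.pred n (move n p) = p

/-- Families of positions. -/
abbrev Sub (T : GameTree) : Type := ∀ n, Set (T.Pos n)

variable {T : GameTree}

/-- The play `x` is played by player `j` according to `s`. -/
def Strategy.Follows (s : T.Strategy) (j : ℕ) (x : T.Play) : Prop :=
  ∀ n, n % 2 = j → x.pos (n + 1) = s.move n (x.pos n)

theorem Play.pos_eq_of_le {x y : T.Play} {m n : ℕ} (hmn : m ≤ n) (h : x.pos n = y.pos n) :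
    x.pos m = y.pos m :=
  thread_eq_of_le x.pred_pos y.pred_pos hmn h

theorem exists_play {n : ℕ} (p : T.Pos n) : ∃ x : T.Play, x.pos n = p := by
  obtain ⟨f, hf, hf'⟩ := exists_thread T.pred n (fun m _ => T.pred_surj m) p
  exact ⟨⟨f, hf'⟩, hf⟩

/-- The position at level `m` of some play through `p`; for `m ≤ n` this is the ancestor of `p`. -/
noncomputable def anc {n : ℕ} (p : T.Pos n) (m : ℕ) : T.Pos m :=
  (exists_play p).choose.pos m

theorem anc_self {n : ℕ} (p : T.Pos n) : anc p n = p := (exists_play p).choose_spec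

theorem anc_pos (x : T.Play) {m n : ℕ} (h : m ≤ n) : anc (x.pos n) m = x.pos m :=
  Play.pos_eq_of_le h (exists_play (x.pos n)).choose_spec

theorem pred_anc {n : ℕ} (p : T.Pos n) (m : ℕ) : T.pred m (anc p (m + 1)) = anc p m :=
  (exists_play p).choose.pred_pos m

theorem anc_pred {m n : ℕ} (p : T.Pos (n + 1)) (h : m ≤ n) : anc (T.pred n p) m = anc p m := by
  obtain ⟨x, rfl⟩ := exists_play p
  rw [x.pred_pos, anc_pos x h, anc_pos x (by omega)]

theorem anc_anc {k m n : ℕ} (p : T.Pos n) (hk : k ≤ m) (hm : m ≤ n) :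
    anc (anc p m) k = anc p k := by
  obtain ⟨x, rfl⟩ := exists_play p
  rw [anc_pos x hm, anc_pos x hk, anc_pos x (hk.trans hm)]

/-- Some strategy. -/
noncomputable def someStrategy (T : GameTree) : T.Strategy where
  move n := Function.surjInv (T.pred_surj n)
  pred_move n := Function.surjInv_eq (T.pred_surj n)

/-- Change one move of a strategy. -/
theorem Strategy.exists_update (s : T.Strategy) {n : ℕ} (q : T.Pos (n + 1)) :
    ∃ t : T.Strategy, t.move n (T.pred n q) = q ∧ ∀ m, n < m → t.move m = s.move m := by
  classical
  refine ⟨⟨Function.update s.move n (Function.update (s.move n) (T.pred n q) q), ?_⟩, by simp, ?_⟩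
  · intro m p
    rcases eq_or_ne m n with rfl | h
    · rcases eq_or_ne p (T.pred m q) with rfl | h
      · simp
      · simp [h, s.pred_move]
    · simp [h, s.pred_move]
  · intro m h
    simp [h.ne']

/-- Player `j` can force the play into `U` from `p`. -/
def CanForce (j : ℕ) (U : T.Sub) (n : ℕ) (p : T.Pos n) : Prop :=
  ∃ s : T.Strategy, ∀ x : T.Play, x.pos n = p →
    (∀ m, n ≤ m → m % 2 = j → x.pos (m + 1) = s.move m (x.pos m)) → ∃ m, n ≤ m ∧ x.pos m ∈ U m

theorem CanForce.of_child {j : ℕ} {U : T.Sub} {n : ℕ} (hn : n % 2 = j) (q : T.Pos (n + 1))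
    (h : CanForce j U (n + 1) q) : CanForce j U n (T.pred n q) := by
  obtain ⟨s, hs⟩ := h
  obtain ⟨t, ht, ht'⟩ := s.exists_update q
  refine ⟨t, fun x hx hxt => ?_⟩
  obtain ⟨m, hm, hU⟩ := hs x (by rw [hxt n le_rfl hn, hx, ht])
    (fun m hm hmj => by rw [hxt m (by omega) hmj, ht' m hm])
  exact ⟨m, by omega, hU⟩

theorem CanForce.of_forall_child {j : ℕ} {U : T.Sub} {n : ℕ} (p : T.Pos n)
    (h : ∀ q, T.pred n q = p → CanForce j U (n + 1) q) : CanForce j U n p := by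
  classical
  have : Nonempty T.Strategy := ⟨T.someStrategy⟩
  choose! s hs using h
  let s' : T.Strategy := ⟨fun m r => (s (anc r (n + 1))).move m r,
    fun m r => (s (anc r (n + 1))).pred_move m r⟩
  refine ⟨s', fun x hx hxs => ?_⟩
  obtain ⟨m, hm, hU⟩ := hs (x.pos (n + 1)) (by rw [x.pred_pos, hx]) x rfl fun m hm hmj => by
    rw [hxs m (by omega) hmj]
    show (s (anc (x.pos m) (n + 1))).move m _ = _
    rw [anc_pos x hm]
  exact ⟨m, by omega, hU⟩

/-- **Gale–Stewart**: in the subtree `a`, which constrains only player `j`, either player `j` forces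
the play into `U`, or the opponent stays in a subtree `V` avoiding `U`. -/
theorem gale_stewart (j N : ℕ) (a U : T.Sub)
    (hpred : ∀ n, N ≤ n → ∀ q, q ∈ a (n + 1) → T.pred n q ∈ a n)
    (hopp : ∀ n, N ≤ n → n % 2 ≠ j → ∀ q, T.pred n q ∈ a n → q ∈ a (n + 1)) :
    ∃ (V : T.Sub) (s : T.Strategy),
      (∀ n, V n ⊆ a n) ∧ (∀ n, N ≤ n → ∀ p ∈ V n, p ∉ U n) ∧
      (∀ n, N ≤ n → ∀ q ∈ V (n + 1), T.pred n q ∈ V n) ∧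
      (∀ n, N ≤ n → n % 2 = j → ∀ q ∈ a (n + 1), T.pred n q ∈ V n → q ∈ V (n + 1)) ∧
      (∀ n, N ≤ n → n % 2 ≠ j → ∀ p ∈ V n, ∃ q ∈ V (n + 1), T.pred n q = p) ∧
      (∀ x : T.Play, x.pos N ∈ a N →
        (∀ n, N ≤ n → n % 2 = j → (x.pos n ∈ V n → x.pos (n + 1) ∈ a (n + 1)) ∧
          (x.pos n ∉ V n → x.pos (n + 1) = s.move n (x.pos n))) →
        (∀ n, N ≤ n → x.pos n ∉ U n) → ∀ n, N ≤ n → x.pos n ∈ V n) := by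
  classical
  let V : T.Sub := fun n => {p | p ∈ a n ∧ ∀ m, N ≤ m → m ≤ n → ¬ CanForce j U m (anc p m)}
  have hV : ∀ n, N ≤ n → ∀ q, q ∈ a (n + 1) → T.pred n q ∈ V n → ¬ CanForce j U (n + 1) q →
      q ∈ V (n + 1) := by
    intro n hn q hq hqV hf
    refine ⟨hq, fun m hm hmn => ?_⟩
    rcases Nat.lt_or_ge n m with h | h
    · obtain rfl : m = n + 1 := by omega
      rwa [anc_self]
    · rw [← anc_pred q h]
      exact hqV.2 m hm h
  have hVforce : ∀ n, N ≤ n → ∀ p ∈ V n, ¬ CanForce j U n p := fun n hn p hp => by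
    have := hp.2 n hn le_rfl
    rwa [anc_self] at this
  let win : ∀ n, T.Pos n → T.Strategy := fun n p =>
    if h : CanForce j U n p then h.choose else T.someStrategy
  let s : T.Strategy := ⟨fun n p =>
    if h : ∃ m, N ≤ m ∧ CanForce j U m (anc p m) then
      (win (Nat.find h) (anc p (Nat.find h))).move n p
    else T.someStrategy.move n p, fun n p => by
      split_ifs <;> exact Strategy.pred_move _ _ _⟩
  refine ⟨V, s, fun n p hp => hp.1, ?_, ?_, ?_, ?_, ?_⟩
  · intro n hn p hp hpU
    exact hVforce n hn p hp ⟨T.someStrategy, fun x hx _ => ⟨n, le_rfl, hx ▸ hpU⟩⟩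
  · intro n hn q hq
    refine ⟨hpred n hn q hq.1, fun m hm hmn => ?_⟩
    rw [anc_pred q hmn]
    exact hq.2 m hm (by omega)
  · intro n hn hnj q hq hqV
    exact hV n hn q hq hqV fun h => hVforce n hn _ hqV (h.of_child hnj q)
  · intro n hn hnj p hp
    by_contra! hcon
    refine hVforce n hn p hp (CanForce.of_forall_child p fun q hq => ?_)
    by_contra hf
    exact hcon q (hV n hn q (hopp n hn hnj q (hq ▸ hp.1)) (hq ▸ hp) hf) hq
  · intro x hxN hx hxU
    by_contra! hcon
    have hn := (Nat.find_spec hcon).1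
    have hnV := (Nat.find_spec hcon).2
    have hmin : ∀ m, N ≤ m → m < Nat.find hcon → x.pos m ∈ V m := fun m hm hlt => by
      by_contra h
      exact Nat.find_min hcon hlt ⟨hm, h⟩
    generalize Nat.find hcon = n at hn hnV hmin
    have hna : x.pos n ∈ a n := by
      rcases hn.eq_or_lt with rfl | hlt
      · exact hxN
      · obtain ⟨m, rfl⟩ : ∃ m, n = m + 1 := ⟨n - 1, by omega⟩
        have hm := hmin m (by omega) (by omega)
        by_cases hmj : m % 2 = j
        · exact (hx m (by omega) hmj).1 hm
        · exact hopp m (by omega) hmj _ (by rw [x.pred_pos]; exact hm.1)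
    have hforce : CanForce j U n (x.pos n) := by
      by_contra hf
      refine hnV ⟨hna, fun m hm hmn => ?_⟩
      rw [anc_pos x hmn]
      rcases hmn.eq_or_lt with rfl | h
      · exact hf
      · exact hVforce m hm _ (hmin m hm h)
    have hwin : win n (x.pos n) = hforce.choose := dif_pos hforce
    obtain ⟨m, hm, hU⟩ := hforce.choose_spec x rfl fun m hm hmj => by
      have hmV : x.pos m ∉ V m := fun h => h.2 n hn hm (by rwa [anc_pos x hm])
      have hex : ∃ k, N ≤ k ∧ CanForce j U k (anc (x.pos m) k) :=
        ⟨n, hn, by rwa [anc_pos x hm]⟩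
      have hfind : Nat.find hex = n := by
        rw [Nat.find_eq_iff]
        refine ⟨⟨hn, by rwa [anc_pos x hm]⟩, fun k hk h => ?_⟩
        rw [anc_pos x (by omega)] at h
        exact hVforce k h.1 _ (hmin k h.1 hk) h.2
      rw [(hx m (by omega) hmj).2 hmV, ← hwin]
      show (if h : ∃ k, N ≤ k ∧ CanForce j U k (anc (x.pos m) k) then
        (win (Nat.find h) (anc (x.pos m) (Nat.find h))).move m (x.pos m)
        else T.someStrategy.move m (x.pos m)) = _
      rw [dif_pos hex, hfind, anc_pos x hm]
    exact hxU m (by omega) hU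

end GameTree

namespace GameTree

variable {T : GameTree}

/-- Membership in `A` is decided at a finite stage of every play. -/
def IsDecided (A : Set T.Play) : Prop :=
  ∀ x, ∃ n, ∀ y : T.Play, y.pos n = x.pos n → (y ∈ A ↔ x ∈ A)

theorem exists_winning_of_isDecided [Subsingleton (T.Pos 0)] {A : Set T.Play} (hA : IsDecided A) :
    (∃ s : T.Strategy, ∀ x, s.Follows 0 x → x ∈ A) ∨
      ∃ s : T.Strategy, ∀ x, s.Follows 1 x → x ∉ A := by
  classical
  let U : T.Sub := fun n => {p | ∀ y : T.Play, y.pos n = p → y ∈ A}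
  obtain ⟨V, s, -, hVU, hVp, hVj, hVo, hs⟩ := gale_stewart 0 0 (fun _ => Set.univ) U
    (fun _ _ _ _ => trivial) (fun _ _ _ _ _ => trivial)
  by_cases hV : ∃ p : T.Pos 0, p ∉ V 0
  · obtain ⟨p, hp⟩ := hV
    refine Or.inl ⟨s, fun x hx => ?_⟩
    by_contra hxA
    refine hp ?_
    rw [Subsingleton.elim p (x.pos 0)]
    exact hs x trivial (fun n _ hn => ⟨fun _ => trivial, fun _ => hx n hn⟩)
      (fun n _ hU => hxA (hU x rfl)) 0 le_rfl
  · push Not at hV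
    let t : T.Strategy := ⟨fun n p => if h : ∃ q ∈ V (n + 1), T.pred n q = p then h.choose else
      T.someStrategy.move n p, fun n p => by
        split_ifs with h
        · exact h.choose_spec.2
        · exact Strategy.pred_move _ _ _⟩
    refine Or.inr ⟨t, fun x hx hxA => ?_⟩
    have hxV : ∀ n, x.pos n ∈ V n := by
      intro n
      induction n with
      | zero => exact hV _
      | succ n ih =>
        by_cases hn : n % 2 = 0
        · exact hVj n (Nat.zero_le _) hn _ trivial (by rwa [x.pred_pos])
        · have h := hVo n (Nat.zero_le _) hn _ ih
          rw [hx n (by omega)]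
          show (if h : ∃ q ∈ V (n + 1), T.pred n q = x.pos n then h.choose else _) ∈ _
          rw [dif_pos h]
          exact h.choose_spec.1
    obtain ⟨n, hn⟩ := hA x
    exact hVU n (Nat.zero_le _) _ (hxV n) fun y hy => (hn y hy).2 hxA

/-- A level preserving map of game trees. -/
structure Hom (S T : GameTree) where
  map : ∀ n, S.Pos n → T.Pos n
  pred_map : ∀ n p, T.pred n (map (n + 1) p) = map n (S.pred n p)

/-- The map on plays induced by a map of game trees. -/
def Hom.play {S T : GameTree} (f : Hom S T) (x : S.Play) : T.Play where
  pos n := f.map n (x.pos n)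
  pred_pos n := by rw [f.pred_map, x.pred_pos]

/-- The composition of two maps of game trees. -/
def Hom.comp {R S T : GameTree} (g : Hom S T) (f : Hom R S) : Hom R T where
  map n p := g.map n (f.map n p)
  pred_map n p := by rw [g.pred_map, f.pred_map]

theorem IsDecided.preimage {S T : GameTree} (f : Hom S T) {A : Set T.Play} (hA : IsDecided A) :
    IsDecided (f.play ⁻¹' A) := fun x => by
  obtain ⟨n, hn⟩ := hA (f.play x)
  exact ⟨n, fun y hy => hn (f.play y) (congrArg (f.map n) hy)⟩

/-- A `K`-covering of a game tree, in the sense of Martin: strategies on `S` are transformed into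
strategies on `T`, locally, in such a way that plays lift; nothing changes up to level `K`. -/
structure Covering (K : ℕ) (S T : GameTree) extends Hom S T where
  strat : ℕ → S.Strategy → T.Strategy
  strat_congr : ∀ j s t n, (∀ m, m ≤ n → s.move m = t.move m) →
    (strat j s).move n = (strat j t).move n
  exists_lift : ∀ j s x, j < 2 → (strat j s).Follows j x →
    ∃ y : S.Play, s.Follows j y ∧ toHom.play y = x
  bijective : ∀ n, n ≤ K → Function.Bijective (map n)
  strat_map : ∀ j s n p, n < K → (strat j s).move n (map n p) = map (n + 1) (s.move n p)

/-- The identity covering. -/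
def Covering.refl (K : ℕ) (T : GameTree) : Covering K T T where
  map _ p := p
  pred_map _ _ := rfl
  strat _ s := s
  strat_congr _ _ _ n h := h n le_rfl
  exists_lift _ _ x _ h := ⟨x, h, rfl⟩
  bijective _ _ := Function.bijective_id
  strat_map _ _ _ _ _ := rfl

/-- The composition of two coverings. -/
def Covering.comp {K : ℕ} {R S T : GameTree} (g : Covering K S T) (f : Covering K R S) :
    Covering K R T where
  toHom := g.toHom.comp f.toHom
  strat j s := g.strat j (f.strat j s)
  strat_congr j s t n h := g.strat_congr j _ _ n fun m hm =>
    f.strat_congr j s t m fun k hk => h k (hk.trans hm)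
  exists_lift j s x hj h := by
    obtain ⟨y, hy, rfl⟩ := g.exists_lift j _ x hj h
    obtain ⟨z, hz, rfl⟩ := f.exists_lift j _ y hj hy
    exact ⟨z, hz, rfl⟩
  bijective n hn := (g.bijective n hn).comp (f.bijective n hn)
  strat_map j s n p hn := by
    show (g.strat j (f.strat j s)).move n (g.map n (f.map n p)) = g.map _ (f.map _ _)
    rw [g.strat_map j _ n _ hn, f.strat_map j _ n _ hn]

/-- A `K`-covering is a `K'`-covering for `K' ≤ K`. -/
def Covering.weaken {K K' : ℕ} {S T : GameTree} (f : Covering K S T) (h : K' ≤ K) :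
    Covering K' S T :=
  { f with
    bijective := fun n hn => f.bijective n (hn.trans h)
    strat_map := fun j s n p hn => f.strat_map j s n p (hn.trans_le h) }

/-! ### Inverse limits of coverings -/

section Limit

variable {K : ℕ} {T : ℕ → GameTree} (c : ∀ i, Covering (K + i) (T (i + 1)) (T i))

/-- Threads of positions at level `n`. -/
def LimitPos (n : ℕ) : Type :=
  {p : ∀ i, (T i).Pos n // ∀ i, (c i).map n (p (i + 1)) = p i}

theorem limit_proj_bijective {i n : ℕ} (h : n ≤ K + i) :
    Function.Bijective fun p : LimitPos c n => p.1 i := by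
  have hbij : ∀ m, i ≤ m → Function.Bijective ((c m).map n) := fun m hm =>
    (c m).bijective n (by omega)
  refine ⟨fun p q hpq => Subtype.ext (funext fun m => ?_), fun q => ?_⟩
  · have hle : ∀ m, i ≤ m → p.1 m = q.1 m := by
      intro m hm
      induction m, hm using Nat.le_induction with
      | base => exact hpq
      | succ m hm ih => exact (hbij m hm).1 (by rw [p.2, q.2, ih])
    rcases le_total i m with hm | hm
    · exact hle m hm
    · exact thread_eq_of_le p.2 q.2 hm hpq
  · obtain ⟨f, hf, hf'⟩ := exists_thread (P := fun m => (T m).Pos n)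
      (fun m => (c m).map n) i (fun m hm => (hbij m hm).2) q
    exact ⟨⟨f, hf'⟩, hf⟩

/-- The inverse limit of a sequence of coverings. -/
def limit : GameTree where
  Pos := LimitPos c
  pred n p := ⟨fun i => (T i).pred n (p.1 i), fun i => by rw [← (c i).pred_map, p.2]⟩
  pred_surj n p := by
    obtain ⟨q, hq⟩ := (T (n + 1)).pred_surj n (p.1 (n + 1))
    obtain ⟨r, hr⟩ := (limit_proj_bijective c (i := n + 1) (n := n + 1) (by omega)).2 q
    refine ⟨r, (limit_proj_bijective c (i := n + 1) (n := n) (by omega)).1 ?_⟩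
    show (T (n + 1)).pred n (r.1 (n + 1)) = p.1 (n + 1)
    rw [← hq]
    exact congrArg _ hr

/-- The projections of the inverse limit. -/
def limitProj (i : ℕ) : Hom (limit c) (T i) where
  map _ p := p.1 i
  pred_map _ _ := rfl

open Classical in
/-- Transfer of a strategy on the inverse limit to `T i`, meaningful below level `K + i`. -/
noncomputable def limitTransfer (i : ℕ) (s : (limit c).Strategy) : (T i).Strategy where
  move n p := if h : n < K + i then
      (s.move n ((limit_proj_bijective c h.le).2 p).choose).1 i
    else (T i).someStrategy.move n p
  pred_move n p := by
    split_ifs with h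
    · refine ((limitProj c i).pred_map n _).trans ((congrArg (fun r : LimitPos c n => r.1 i)
        (s.pred_move n _)).trans ?_)
      exact ((limit_proj_bijective c h.le).2 p).choose_spec
    · exact Strategy.pred_move _ _ _

theorem limitTransfer_move {i n : ℕ} (h : n < K + i) (s : (limit c).Strategy)
    (p : LimitPos c n) : (limitTransfer c i s).move n (p.1 i) = (s.move n p).1 i := by
  have hp := ((limit_proj_bijective c h.le).2 (p.1 i)).choose_spec
  rw [limitTransfer]
  simp only [h, dite_true]
  rw [(limit_proj_bijective c h.le).1 hp]

theorem strat_limitTransfer {i n : ℕ} (h : n < K + i) (j : ℕ) (s : (limit c).Strategy) :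
    ((c i).strat j (limitTransfer c (i + 1) s)).move n = (limitTransfer c i s).move n := by
  funext p
  obtain ⟨p, rfl⟩ := (limit_proj_bijective c h.le).2 p
  show ((c i).strat j (limitTransfer c (i + 1) s)).move n (p.1 i) = _
  rw [limitTransfer_move c h, ← p.2 i, (c i).strat_map j _ n _ h,
    limitTransfer_move c (by omega : n < K + (i + 1)), (s.move n p).2 i]

/-- The transfer to `T i` through `T (i + d)`. -/
noncomputable def limitStratAux (j : ℕ) (s : (limit c).Strategy) :
    ℕ → ∀ i, (T i).Strategy
  | 0, i => limitTransfer c i s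
  | d + 1, i => (c i).strat j (limitStratAux j s d (i + 1))

theorem limitStratAux_succ (j : ℕ) (s : (limit c).Strategy) (d : ℕ) :
    ∀ i n, n < K + i + d →
      (limitStratAux c j s (d + 1) i).move n = (limitStratAux c j s d i).move n := by
  induction d with
  | zero => exact fun i n h => strat_limitTransfer c (by omega) j s
  | succ d ih =>
    exact fun i n h => (c i).strat_congr j _ _ n fun m hm => ih (i + 1) m (by omega)

theorem limitStratAux_eq (j : ℕ) (s : (limit c).Strategy) {i n d e : ℕ} (hd : n < K + i + d)
    (hde : d ≤ e) :
    (limitStratAux c j s e i).move n = (limitStratAux c j s d i).move n := by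
  induction e, hde using Nat.le_induction with
  | base => rfl
  | succ e he ih => rw [limitStratAux_succ c j s e i n (by omega), ih]

/-- The transfer of a strategy on the inverse limit to `T i`. -/
noncomputable def limitStrat (j : ℕ) (s : (limit c).Strategy) (i : ℕ) : (T i).Strategy where
  move n := (limitStratAux c j s (n + 1) i).move n
  pred_move n := (limitStratAux c j s (n + 1) i).pred_move n

theorem limitStrat_move (j : ℕ) (s : (limit c).Strategy) {i n d : ℕ} (hd : n < K + i + d) :
    (limitStrat c j s i).move n = (limitStratAux c j s d i).move n := by
  rcases le_total (n + 1) d with h | h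
  · exact (limitStratAux_eq c j s (by omega) h).symm
  · exact limitStratAux_eq c j s hd h

theorem strat_limitStrat (j : ℕ) (s : (limit c).Strategy) (i : ℕ) :
    (c i).strat j (limitStrat c j s (i + 1)) = limitStrat c j s i := by
  have : ∀ n, ((c i).strat j (limitStrat c j s (i + 1))).move n = (limitStrat c j s i).move n :=
    fun n => by
      rw [limitStrat_move c j s (d := n + 2) (by omega)]
      exact (c i).strat_congr j _ _ n fun m hm => limitStrat_move c j s (by omega)
  generalize (c i).strat j (limitStrat c j s (i + 1)) = a at this ⊢
  generalize limitStrat c j s i = b at this ⊢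
  cases a; cases b
  congr
  exact funext this

theorem limitTransfer_congr {i n : ℕ} {s t : (limit c).Strategy} (h : s.move n = t.move n) :
    (limitTransfer c i s).move n = (limitTransfer c i t).move n := by
  simp only [limitTransfer, h]

theorem limitStratAux_congr (j : ℕ) {s t : (limit c).Strategy} (d : ℕ) : ∀ i n,
    (∀ m, m ≤ n → s.move m = t.move m) →
    (limitStratAux c j s d i).move n = (limitStratAux c j t d i).move n := by
  induction d with
  | zero => exact fun i n h => limitTransfer_congr c (h n le_rfl)
  | succ d ih =>
    exact fun i n h => (c i).strat_congr j _ _ n fun m hm => ih (i + 1) m fun k hk =>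
      h k (hk.trans hm)

/-- The inverse limit covers the first tree of the sequence. -/
noncomputable def limitCovering : Covering K (limit c) (T 0) where
  toHom := limitProj c 0
  strat j s := limitStrat c j s 0
  strat_congr j s t n h := limitStratAux_congr c j (n + 1) 0 n h
  exists_lift j s x hj hx := by
    have step : ∀ (i : ℕ) (x : {x : (T i).Play // (limitStrat c j s i).Follows j x}),
        ∃ y : {x : (T (i + 1)).Play // (limitStrat c j s (i + 1)).Follows j x},
          (c i).toHom.play y.1 = x.1 := fun i x => by
      obtain ⟨y, hy, hyx⟩ := (c i).exists_lift j (limitStrat c j s (i + 1)) x.1 hj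
        (by rw [strat_limitStrat]; exact x.2)
      exact ⟨⟨y, hy⟩, hyx⟩
    choose f hf using step
    let z : ∀ i, {x : (T i).Play // (limitStrat c j s i).Follows j x} :=
      fun i => Nat.rec ⟨x, hx⟩ f i
    have hz : ∀ i, (c i).toHom.play (z (i + 1)).1 = (z i).1 := fun i => hf i (z i)
    let y : (limit c).Play :=
      ⟨fun n => ⟨fun i => (z i).1.pos n, fun i => congrArg (fun w => w.pos n) (hz i)⟩,
        fun n => Subtype.ext (funext fun i => (z i).1.pred_pos n)⟩
    refine ⟨y, fun n hn => ?_, rfl⟩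
    refine (limit_proj_bijective c (i := n + 1) (n := n + 1) (by omega)).1 ?_
    show (z (n + 1)).1.pos (n + 1) = (s.move n (y.pos n)).1 (n + 1)
    rw [(z (n + 1)).2 n hn, limitStrat_move c j s (d := 0) (by omega)]
    exact limitTransfer_move c (by omega) s (y.pos n)
  bijective n hn := limit_proj_bijective c (by omega)
  strat_map j s n p hn := by
    rw [limitStrat_move c j s (d := 0) (by omega)]
    exact limitTransfer_move c (by omega) s p

end Limit

end GameTree

namespace GameTree

variable {T : GameTree}

/-! ### Unraveling closed games -/

/-- The conclusion of `gale_stewart`. -/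
structure IsBarrier (j N : ℕ) (a U V : T.Sub) (s : T.Strategy) : Prop where
  subset : ∀ n, V n ⊆ a n
  disjoint : ∀ n, N ≤ n → ∀ p ∈ V n, p ∉ U n
  pred_mem : ∀ n, N ≤ n → ∀ q ∈ V (n + 1), T.pred n q ∈ V n
  mem_of_pred : ∀ n, N ≤ n → n % 2 = j → ∀ q ∈ a (n + 1), T.pred n q ∈ V n → q ∈ V (n + 1)
  exists_child : ∀ n, N ≤ n → n % 2 ≠ j → ∀ p ∈ V n, ∃ q ∈ V (n + 1), T.pred n q = p
  forall_mem : ∀ x : T.Play, x.pos N ∈ a N →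
    (∀ n, N ≤ n → n % 2 = j → (x.pos n ∈ V n → x.pos (n + 1) ∈ a (n + 1)) ∧
      (x.pos n ∉ V n → x.pos (n + 1) = s.move n (x.pos n))) →
    (∀ n, N ≤ n → x.pos n ∉ U n) → ∀ n, N ≤ n → x.pos n ∈ V n

open Classical in
/-- A choice of a barrier, when there is one. -/
noncomputable def barrier (j N : ℕ) (a U : T.Sub) : T.Sub × T.Strategy :=
  if h : ∃ V : T.Sub × T.Strategy, IsBarrier j N a U V.1 V.2 then h.choose
  else (⊥, T.someStrategy)

theorem isBarrier_barrier (j N : ℕ) (a U : T.Sub)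
    (hpred : ∀ n, N ≤ n → ∀ q, q ∈ a (n + 1) → T.pred n q ∈ a n)
    (hopp : ∀ n, N ≤ n → n % 2 ≠ j → ∀ q, T.pred n q ∈ a n → q ∈ a (n + 1)) :
    IsBarrier j N a U (barrier j N a U).1 (barrier j N a U).2 := by
  have h : ∃ V : T.Sub × T.Strategy, IsBarrier j N a U V.1 V.2 := by
    obtain ⟨V, s, h1, h2, h3, h4, h5, h6⟩ := gale_stewart j N a U hpred hopp
    exact ⟨(V, s), h1, h2, h3, h4, h5, h6⟩
  rw [barrier, dif_pos h]
  exact h.choose_spec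

/-- The positions comparable with `u`. -/
def cone {m : ℕ} (u : T.Pos m) : T.Sub := fun n => {q | ∀ k, k ≤ n → k ≤ m → anc q k = anc u k}

theorem pred_mem_cone {m n : ℕ} {u : T.Pos m} {q : T.Pos (n + 1)} (h : q ∈ cone u (n + 1)) :
    T.pred n q ∈ cone u n := fun k hk hkm => by
  rw [anc_pred q hk]; exact h k (by omega) hkm

theorem pos_mem_cone (x : T.Play) (m n : ℕ) : x.pos n ∈ cone (x.pos m) n := fun k hk hkm => by
  rw [anc_pos x hk, anc_pos x hkm]

theorem eq_of_mem_cone {m n : ℕ} {u : T.Pos m} {q : T.Pos n} (h : q ∈ cone u n) (hn : n ≤ m) :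
    q = anc u n := by
  rw [← h n le_rfl hn, anc_self]

theorem exists_child_cone {m n : ℕ} {u : T.Pos m} {p : T.Pos n} (h : p ∈ cone u n) :
    ∃ q ∈ cone u (n + 1), T.pred n q = p := by
  rcases Nat.lt_or_ge n m with hn | hn
  · refine ⟨anc u (n + 1), fun k hk hkm => anc_anc u hk (by omega), ?_⟩
    rw [pred_anc, eq_of_mem_cone h hn.le]
  · obtain ⟨q, rfl⟩ := T.pred_surj n p
    exact ⟨q, fun k hk hkm => by rw [← anc_pred q (hkm.trans hn), h k (hkm.trans hn) hkm], rfl⟩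

/-- A quasistrategy for player `0` from the position `p` at level `K + 1`. -/
structure IsQuasi (K : ℕ) (p : T.Pos (K + 1)) (a : T.Sub) : Prop where
  mem : p ∈ a (K + 1)
  pred_mem : ∀ n, K + 1 ≤ n → ∀ q ∈ a (n + 1), T.pred n q ∈ a n
  mem_of_pred : ∀ n, K + 1 ≤ n → n % 2 = 1 → ∀ q, T.pred n q ∈ a n → q ∈ a (n + 1)
  exists_child : ∀ n, K + 1 ≤ n → n % 2 = 0 → ∀ p ∈ a n, ∃ q ∈ a (n + 1), T.pred n q = p

/-- A quasistrategy for player `1` inside `a` that stays in `C`. -/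
structure IsSafe (K : ℕ) (C a : T.Sub) (p : T.Pos (K + 2)) (b : T.Sub) : Prop where
  mem : p ∈ b (K + 2)
  subset : ∀ n, K + 2 ≤ n → ∀ q ∈ b n, q ∈ C n ∧ q ∈ a n
  pred_mem : ∀ n, K + 2 ≤ n → ∀ q ∈ b (n + 1), T.pred n q ∈ b n
  mem_of_pred : ∀ n, K + 2 ≤ n → n % 2 = 0 → ∀ q ∈ a (n + 1), T.pred n q ∈ b n → q ∈ b (n + 1)
  exists_child : ∀ n, K + 2 ≤ n → n % 2 = 1 → ∀ p ∈ b n, ∃ q ∈ b (n + 1), T.pred n q = p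

/-- The answers of player `1` to a quasistrategy `a`: either a position in `a` outside `C`,
or a quasistrategy staying in `C`. -/
def IsAnswer (K : ℕ) (C a : T.Sub) (p : T.Pos (K + 2)) (b : T.Sub) : Prop :=
  (∃ m, ∃ u : T.Pos m, K + 2 ≤ m ∧ m % 2 = 0 ∧ u ∈ a m ∧ u ∉ C m ∧ anc u (K + 2) = p ∧ b = cone u) ∨
    IsSafe K C a p b

theorem IsAnswer.pred_mem {K : ℕ} {C a b : T.Sub} {p : T.Pos (K + 2)} (h : IsAnswer K C a p b)
    {n : ℕ} (hn : K + 2 ≤ n) {q : T.Pos (n + 1)} (hq : q ∈ b (n + 1)) : T.pred n q ∈ b n := by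
  rcases h with ⟨m, u, -, -, -, -, -, rfl⟩ | h
  · exact pred_mem_cone hq
  · exact h.pred_mem n hn q hq

theorem IsAnswer.exists_child {K : ℕ} {C a b : T.Sub} {y : T.Pos (K + 1)} {p : T.Pos (K + 2)}
    (ha : IsQuasi K y a) (h : IsAnswer K C a p b)
    {n : ℕ} (hn : K + 2 ≤ n) {q : T.Pos n} (hq : q ∈ b n) : ∃ r ∈ b (n + 1), T.pred n r = q := by
  rcases h with ⟨m, u, -, -, -, -, -, rfl⟩ | h
  · exact exists_child_cone hq
  · rcases Nat.mod_two_eq_zero_or_one n with h0 | h1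
    · obtain ⟨r, hr, rfl⟩ := ha.exists_child n (by omega) h0 q (h.subset n hn q hq).2
      exact ⟨r, h.mem_of_pred n hn h0 r hr hq, rfl⟩
    · exact h.exists_child n hn h1 q hq

/-- Every move at level `K + 1` can be complemented by an answer. -/
theorem exists_isAnswer {K : ℕ} (hK : K % 2 = 0) (C : T.Sub)
    (hC : ∀ n, ∀ q ∈ C (n + 1), T.pred n q ∈ C n) {a : T.Sub} {p : T.Pos (K + 1)}
    (ha : IsQuasi K p a) (q : T.Pos (K + 2)) (hq : T.pred (K + 1) q = p) :
    ∃ b, IsAnswer K C a q b ∧ q ∈ b (K + 2) := by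
  by_cases h : ∃ m, ∃ u : T.Pos m, K + 2 ≤ m ∧ m % 2 = 0 ∧ u ∈ a m ∧ u ∉ C m ∧ anc u (K + 2) = q
  · obtain ⟨m, u, hm, hm2, hua, huC, hu⟩ := h
    refine ⟨cone u, Or.inl ⟨m, u, hm, hm2, hua, huC, hu, rfl⟩, fun k hk hkm => ?_⟩
    rw [← hu, anc_anc u hk hm]
  · push Not at h
    have hqa : q ∈ a (K + 2) := ha.mem_of_pred _ le_rfl (by omega) q (hq ▸ ha.mem)
    refine ⟨fun n => {r | r ∈ a n ∧ anc r (K + 2) = q}, Or.inr ⟨⟨hqa, anc_self q⟩, ?_, ?_, ?_, ?_⟩,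
      ⟨hqa, anc_self q⟩⟩
    · rintro n hn r ⟨hr, hrq⟩
      refine ⟨?_, hr⟩
      rcases Nat.mod_two_eq_zero_or_one n with h0 | h1
      · by_contra hrC
        exact h n r hn h0 hr hrC hrq
      · obtain ⟨t, rfl⟩ := T.pred_surj n r
        have ht := ha.mem_of_pred n (by omega) h1 t hr
        refine hC n t ?_
        by_contra htC
        exact h (n + 1) t (by omega) (by omega) ht htC (by rw [← hrq, anc_pred t hn])
    · rintro n hn r ⟨hr, hrq⟩
      exact ⟨ha.pred_mem n (by omega) r hr, by rw [anc_pred r hn, hrq]⟩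
    · rintro n hn - r hr ⟨-, hrq⟩
      exact ⟨hr, by rw [← hrq, anc_pred r hn]⟩
    · rintro n hn hn1 r ⟨hr, hrq⟩
      obtain ⟨t, rfl⟩ := T.pred_surj n r
      exact ⟨t, ⟨ha.mem_of_pred n (by omega) hn1 t hr, by rw [← hrq, anc_pred t hn]⟩, rfl⟩

/-- Positions of the unraveled tree. -/
structure IsUnravelPos (K : ℕ) (C : T.Sub) (n : ℕ) (p : T.Pos n) (a b : T.Sub) : Prop where
  fst_eq : n ≤ K → a = ⊥
  snd_eq : n ≤ K + 1 → b = ⊥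
  isQuasi : K < n → IsQuasi K (anc p (K + 1)) a
  isAnswer : K + 1 < n → IsAnswer K C a (anc p (K + 2)) b
  mem : K + 1 < n → p ∈ b n

theorem IsUnravelPos.pred {K : ℕ} {C : T.Sub} {n : ℕ} {p : T.Pos (n + 1)} {a b : T.Sub}
    (h : IsUnravelPos K C (n + 1) p a b) :
    IsUnravelPos K C n (T.pred n p) (if n ≤ K then ⊥ else a) (if n ≤ K + 1 then ⊥ else b) where
  fst_eq hn := if_pos hn
  snd_eq hn := if_pos hn
  isQuasi hn := by
    rw [if_neg (by omega), anc_pred p (by omega)]; exact h.isQuasi (by omega)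
  isAnswer hn := by
    rw [if_neg (by omega), if_neg (by omega), anc_pred p (by omega)]; exact h.isAnswer (by omega)
  mem hn := by
    rw [if_neg (by omega)]; exact (h.isAnswer (by omega)).pred_mem (by omega) (h.mem (by omega))

theorem isUnravelPos_bot {K : ℕ} (C : T.Sub) {n : ℕ} (hn : n ≤ K) (p : T.Pos n) :
    IsUnravelPos K C n p ⊥ ⊥ :=
  ⟨fun _ => rfl, fun _ => rfl, fun h => by omega, fun h => by omega, fun h => by omega⟩

theorem IsUnravelPos.of_isQuasi {K : ℕ} (C : T.Sub) {p : T.Pos (K + 1)} {a : T.Sub}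
    (h : IsQuasi K p a) : IsUnravelPos K C (K + 1) p a ⊥ :=
  ⟨fun h => by omega, fun _ => rfl, fun _ => by rwa [anc_self], fun h => by omega,
    fun h => by omega⟩

section Unravel

variable (K : ℕ) (hK : K % 2 = 0) (C : T.Sub) (hC : ∀ n, ∀ q ∈ C (n + 1), T.pred n q ∈ C n)

/-- The unraveling of the closed game `C`. -/
def unravel : GameTree where
  Pos n := {x : T.Pos n × T.Sub × T.Sub // IsUnravelPos K C n x.1 x.2.1 x.2.2}
  pred n x := ⟨(T.pred n x.1.1, if n ≤ K then ⊥ else x.1.2.1, if n ≤ K + 1 then ⊥ else x.1.2.2),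
    x.2.pred⟩
  pred_surj := by
    rintro n ⟨⟨p, a, b⟩, hx⟩
    have key : ∃ q a' b', IsUnravelPos K C (n + 1) q a' b' ∧ T.pred n q = p ∧
        (if n ≤ K then ⊥ else a') = a ∧ (if n ≤ K + 1 then ⊥ else b') = b := by
      dsimp only at hx
      rcases lt_trichotomy n K with hn | rfl | hn
      · obtain ⟨q, rfl⟩ := T.pred_surj n p
        exact ⟨q, ⊥, ⊥, isUnravelPos_bot C hn q, rfl, by rw [hx.fst_eq hn.le, ite_self],
          by rw [hx.snd_eq (by omega), ite_self]⟩
      · obtain ⟨q, rfl⟩ := T.pred_surj n p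
        refine ⟨q, fun _ => Set.univ, ⊥, IsUnravelPos.of_isQuasi C ⟨trivial, fun _ _ _ _ => trivial,
          fun _ _ _ _ _ => trivial, fun m _ _ r _ => ?_⟩, rfl,
          by rw [hx.fst_eq le_rfl, if_pos le_rfl], by rw [hx.snd_eq (by omega), ite_self]⟩
        obtain ⟨t, ht⟩ := T.pred_surj m r
        exact ⟨t, trivial, ht⟩
      · rcases (Nat.succ_le_of_lt hn).eq_or_lt with rfl | hn1
        · obtain ⟨q, rfl⟩ := T.pred_surj _ p
          have ha := hx.isQuasi (by omega)
          obtain ⟨b', hb, hqb⟩ := exists_isAnswer hK C hC ha q (by rw [anc_self])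
          exact ⟨q, a, b', ⟨fun h => by omega, fun h => by omega,
            fun _ => by rwa [← anc_pred q le_rfl], fun _ => by rwa [anc_self], fun _ => hqb⟩,
            rfl, if_neg (by omega), by rw [hx.snd_eq le_rfl]; exact if_pos le_rfl⟩
        · have ha := hx.isQuasi (by omega)
          have hb := hx.isAnswer (by omega)
          obtain ⟨q, hq, rfl⟩ := hb.exists_child ha (by omega) (hx.mem (by omega))
          exact ⟨q, a, b, ⟨fun h => by omega, fun h => by omega,
            fun _ => by rwa [← anc_pred q (by omega)], fun _ => by rwa [← anc_pred q (by omega)],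
            fun _ => hq⟩, rfl, if_neg (by omega), if_neg (by omega)⟩
    obtain ⟨q, a', b', h, rfl, rfl, rfl⟩ := key
    exact ⟨⟨(q, a', b'), h⟩, rfl⟩

/-- The projection of the unraveled tree. -/
def unravelHom : Hom (unravel K hK C hC) T where
  map _ x := x.1.1
  pred_map _ _ := rfl

variable {K hK C hC}

/-- The position of the unraveled tree proposed by `f` at the given data. -/
theorem unravel_move_fst {n : ℕ} (s : (unravel K hK C hC).Strategy)
    (x : (unravel K hK C hC).Pos n) : T.pred n (s.move n x).1.1 = x.1.1 :=
  congrArg (fun y => y.1.1) (s.pred_move n x)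

theorem unravel_move_quasi {n : ℕ} (s : (unravel K hK C hC).Strategy)
    (x : (unravel K hK C hC).Pos n) (hn : K < n) : (s.move n x).1.2.1 = x.1.2.1 := by
  have := congrArg (fun y => y.1.2.1) (s.pred_move n x)
  rw [← this]
  exact (if_neg (by omega)).symm

theorem unravel_move_answer {n : ℕ} (s : (unravel K hK C hC).Strategy)
    (x : (unravel K hK C hC).Pos n) (hn : K + 1 < n) : (s.move n x).1.2.2 = x.1.2.2 := by
  have := congrArg (fun y => y.1.2.2) (s.pred_move n x)
  rw [← this]
  exact (if_neg (by omega)).symm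

theorem unravel_move_mem {n : ℕ} (s : (unravel K hK C hC).Strategy)
    (x : (unravel K hK C hC).Pos n) (hn : K + 1 < n) :
    (s.move n x).1.1 ∈ x.1.2.2 (n + 1) := by
  rw [← unravel_move_answer s x hn]
  exact (s.move n x).2.mem (by omega)

variable (hK hC)

open Classical in
/-- The move in `T` given by a function on the unraveled tree. -/
noncomputable def runAt {n : ℕ}
    (f : (unravel K hK C hC).Pos n → (unravel K hK C hC).Pos (n + 1))
    (p : T.Pos n) (a b : T.Sub) : T.Pos (n + 1) :=
  if h : IsUnravelPos K C n p a b then (f ⟨(p, a, b), h⟩).1.1 else T.someStrategy.move n p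

theorem pred_runAt {n : ℕ} (s : (unravel K hK C hC).Strategy) (p : T.Pos n) (a b : T.Sub) :
    T.pred n (runAt hK hC (s.move n) p a b) = p := by
  rw [runAt]
  split_ifs with h
  · exact unravel_move_fst s _
  · exact Strategy.pred_move _ _ _

theorem runAt_eq {n : ℕ} (f : (unravel K hK C hC).Pos n → (unravel K hK C hC).Pos (n + 1))
    (x : (unravel K hK C hC).Pos n) : runAt hK hC f x.1.1 x.1.2.1 x.1.2.2 = (f x).1.1 :=
  dif_pos x.2

/-- The goal of player `0` in the auxiliary game. -/
def exitGoal (C a : T.Sub) : T.Sub := fun n => {p | n % 2 = 0 ∧ p ∈ a n ∧ p ∉ C n}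

/-- The quasistrategy played by `f` at level `K`. -/
def quasiAt (f : (unravel K hK C hC).Pos K → (unravel K hK C hC).Pos (K + 1)) (p : T.Pos K) :
    T.Sub :=
  (f ⟨(p, ⊥, ⊥), isUnravelPos_bot C le_rfl p⟩).1.2.1

open Classical in
/-- The move of player `0` at `p` when the quasistrategy `a` has been played. -/
noncomputable def moveZeroAux (a : T.Sub) {n : ℕ}
    (g : (unravel K hK C hC).Pos n → (unravel K hK C hC).Pos (n + 1)) (p : T.Pos n) :
    T.Pos (n + 1) :=
  let V := barrier 0 (K + 2) a (exitGoal C a)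
  if h : ∃ m, K + 2 ≤ m ∧ m ≤ n ∧ anc p m ∈ exitGoal C a m then
    runAt hK hC g p a (cone (anc p (Nat.find h)))
  else if p ∈ V.1 n then runAt hK hC g p a V.1 else V.2.move n p

/-- The move of player `0` in `T` at level `n > K` at `p`, in terms of the moves at levels `K` and
`n` in the unraveled tree. -/
noncomputable def moveZero {n : ℕ}
    (f : (unravel K hK C hC).Pos K → (unravel K hK C hC).Pos (K + 1))
    (g : (unravel K hK C hC).Pos n → (unravel K hK C hC).Pos (n + 1)) (p : T.Pos n) :
    T.Pos (n + 1) :=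
  moveZeroAux hK hC (quasiAt hK hC f (anc p K)) g p

/-- The witnesses that player `1` answers the quasistrategy `a` with the position `u`. -/
structure IsReply (f : (unravel K hK C hC).Pos (K + 1) → (unravel K hK C hC).Pos (K + 2))
    (y : T.Pos (K + 1)) {m : ℕ} (u : T.Pos m) (a : T.Sub) : Prop where
  isQuasi : IsQuasi K y a
  even : m % 2 = 0
  mem : u ∈ a m
  notMem : u ∉ C m
  fst_eq : (f ⟨(y, a, ⊥), .of_isQuasi C isQuasi⟩).1.1 = anc u (K + 2)
  snd_eq : (f ⟨(y, a, ⊥), .of_isQuasi C isQuasi⟩).1.2.2 = cone u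

/-- The goal of player `1` in the auxiliary game. -/
def replyGoal (f : (unravel K hK C hC).Pos (K + 1) → (unravel K hK C hC).Pos (K + 2))
    (y : T.Pos (K + 1)) : T.Sub := fun _ => {u | ∃ a, IsReply hK hC f y u a}

open Classical in
/-- The answer given by `f` at `y` to `a`. -/
noncomputable def answerAt
    (f : (unravel K hK C hC).Pos (K + 1) → (unravel K hK C hC).Pos (K + 2))
    (y : T.Pos (K + 1)) (a : T.Sub) : T.Sub :=
  if h : IsQuasi K y a then (f ⟨(y, a, ⊥), .of_isQuasi C h⟩).1.2.2 else ⊥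

open Classical in
/-- The move of player `1` at `p` when the position at level `K + 1` is `y`. -/
noncomputable def moveOneAux (y : T.Pos (K + 1)) {n : ℕ}
    (f : (unravel K hK C hC).Pos (K + 1) → (unravel K hK C hC).Pos (K + 2))
    (g : (unravel K hK C hC).Pos n → (unravel K hK C hC).Pos (n + 1)) (p : T.Pos n) :
    T.Pos (n + 1) :=
  let V := barrier 1 (K + 1) (fun _ => Set.univ) (replyGoal hK hC f y)
  if h : ∃ m, K + 2 ≤ m ∧ m ≤ n ∧ anc p m ∈ replyGoal hK hC f y m then
    runAt hK hC g p (Nat.find_spec h).2.2.choose (cone (anc p (Nat.find h)))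
  else if p ∈ V.1 n then runAt hK hC g p V.1 (if n ≤ K + 1 then ⊥ else answerAt hK hC f y V.1)
  else V.2.move n p

/-- The move of player `1` in `T` at level `n > K` at `p`, in terms of the moves at levels `K + 1`
and `n` in the unraveled tree. -/
noncomputable def moveOne {n : ℕ}
    (f : (unravel K hK C hC).Pos (K + 1) → (unravel K hK C hC).Pos (K + 2))
    (g : (unravel K hK C hC).Pos n → (unravel K hK C hC).Pos (n + 1)) (p : T.Pos n) :
    T.Pos (n + 1) :=
  moveOneAux hK hC (anc p (K + 1)) f g p

/-- The transfer of strategies from the unraveled tree. -/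
noncomputable def unravelStrat (j : ℕ) (s : (unravel K hK C hC).Strategy) : T.Strategy where
  move n p :=
    if n ≤ K then runAt hK hC (s.move n) p ⊥ ⊥
    else if j = 0 then moveZero hK hC (s.move K) (s.move n) p
    else moveOne hK hC (s.move (K + 1)) (s.move n) p
  pred_move n p := by
    dsimp only [moveZero, moveOne, moveZeroAux, moveOneAux]
    split_ifs
    all_goals first
      | exact pred_runAt _ _ _ _ _ _
      | exact Strategy.pred_move _ _ _

theorem unravelStrat_congr (j : ℕ) (s t : (unravel K hK C hC).Strategy) (n : ℕ)
    (h : ∀ m, m ≤ n → s.move m = t.move m) :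
    (unravelStrat hK hC j s).move n = (unravelStrat hK hC j t).move n := by
  funext p
  simp only [unravelStrat]
  split_ifs with h1
  · rw [h n le_rfl]
  · rw [h n le_rfl, h K (by omega)]
  · rw [h n le_rfl, h (K + 1) (by omega)]

/-- A play of the unraveled tree over a play of `T`. -/
def liftPlay (x : T.Play) (a b : T.Sub) (ha : IsQuasi K (x.pos (K + 1)) a)
    (hb : IsAnswer K C a (x.pos (K + 2)) b) (hx : ∀ n, K + 2 ≤ n → x.pos n ∈ b n) :
    (unravel K hK C hC).Play where
  pos n := ⟨(x.pos n, if n ≤ K then ⊥ else a, if n ≤ K + 1 then ⊥ else b),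
    ⟨fun h => if_pos h, fun h => if_pos h,
      fun h => by rw [if_neg (by omega), anc_pos x (by omega)]; exact ha,
      fun h => by rw [if_neg (by omega), if_neg (by omega), anc_pos x (by omega)]; exact hb,
      fun h => by
        show x.pos n ∈ (if n ≤ K + 1 then ⊥ else b : T.Sub) n
        rw [if_neg (by omega)]; exact hx n h⟩⟩
  pred_pos n := by
    refine Subtype.ext (Prod.ext (x.pred_pos n) (Prod.ext ?_ ?_))
    · show (if n ≤ K then ⊥ else if n + 1 ≤ K then ⊥ else a) = if n ≤ K then ⊥ else a
      split_ifs <;> first | rfl | omega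
    · show (if n ≤ K + 1 then ⊥ else if n + 1 ≤ K + 1 then ⊥ else b) = if n ≤ K + 1 then ⊥ else b
      split_ifs <;> first | rfl | omega

theorem unravel_ext {n : ℕ} {x y : (unravel K hK C hC).Pos n} (h1 : x.1.1 = y.1.1)
    (h2 : x.1.2.1 = y.1.2.1) (h3 : x.1.2.2 = y.1.2.2) : x = y :=
  Subtype.ext (Prod.ext h1 (Prod.ext h2 h3))


theorem liftPlay_succ {x : T.Play} {a b : T.Sub} (ha : IsQuasi K (x.pos (K + 1)) a)
    (hb : IsAnswer K C a (x.pos (K + 2)) b) (hx : ∀ n, K + 2 ≤ n → x.pos n ∈ b n)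
    (s : (unravel K hK C hC).Strategy) (n : ℕ)
    (h1 : (s.move n ((liftPlay hK hC x a b ha hb hx).pos n)).1.1 = x.pos (n + 1))
    (h2 : n = K → (s.move n ((liftPlay hK hC x a b ha hb hx).pos n)).1.2.1 = a)
    (h3 : n = K + 1 → (s.move n ((liftPlay hK hC x a b ha hb hx).pos n)).1.2.2 = b) :
    (liftPlay hK hC x a b ha hb hx).pos (n + 1) =
      s.move n ((liftPlay hK hC x a b ha hb hx).pos n) := by
  refine unravel_ext hK hC h1.symm ?_ ?_
  · show (if n + 1 ≤ K then ⊥ else a) = _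
    rcases lt_trichotomy n K with h | h | h
    · rw [if_pos (by omega)]; exact ((s.move n _).2.fst_eq h).symm
    · rw [if_neg (by omega), h2 h]
    · rw [if_neg (by omega), unravel_move_quasi s _ h]; exact (if_neg (by omega)).symm
  · show (if n + 1 ≤ K + 1 then ⊥ else b) = _
    rcases lt_trichotomy n (K + 1) with h | h | h
    · rw [if_pos (by omega)]; exact ((s.move n _).2.snd_eq h).symm
    · rw [if_neg (by omega), h3 h]
    · rw [if_neg (by omega), unravel_move_answer s _ h]; exact (if_neg (by omega)).symm

theorem runAt_liftPlay {x : T.Play} {a b : T.Sub} (ha : IsQuasi K (x.pos (K + 1)) a)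
    (hb : IsAnswer K C a (x.pos (K + 2)) b) (hx : ∀ n, K + 2 ≤ n → x.pos n ∈ b n)
    (s : (unravel K hK C hC).Strategy) {n : ℕ} {a' b' : T.Sub}
    (ha' : a' = if n ≤ K then ⊥ else a) (hb' : b' = if n ≤ K + 1 then ⊥ else b) :
    (s.move n ((liftPlay hK hC x a b ha hb hx).pos n)).1.1 =
      runAt hK hC (s.move n) (x.pos n) a' b' := by
  subst ha' hb'
  exact (runAt_eq hK hC (s.move n) ((liftPlay hK hC x a b ha hb hx).pos n)).symm

/-- A move inside the cone of a position of the play follows the play. -/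
theorem move_fst_of_cone (x : T.Play) {n m : ℕ} (s : (unravel K hK C hC).Strategy)
    (p : (unravel K hK C hC).Pos n) (hn : K + 1 < n) (hp : p.1.2.2 = cone (x.pos m))
    (hnm : n < m) : (s.move n p).1.1 = x.pos (n + 1) := by
  have h := (s.move n p).2.mem (by omega)
  rw [unravel_move_answer s _ hn, hp] at h
  rw [eq_of_mem_cone h (by omega), anc_pos x (by omega)]

theorem isQuasi_quasiAt (s : (unravel K hK C hC).Strategy) (p : T.Pos K) :
    IsQuasi K (runAt hK hC (s.move K) p ⊥ ⊥) (quasiAt hK hC (s.move K) p) := by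
  rw [runAt, dif_pos (isUnravelPos_bot C le_rfl p)]
  have := (s.move K ⟨(p, ⊥, ⊥), isUnravelPos_bot C le_rfl p⟩).2.isQuasi (Nat.lt_succ_self K)
  rwa [anc_self] at this

theorem exists_lift_zero (s : (unravel K hK C hC).Strategy) (x : T.Play)
    (hx : (unravelStrat hK hC 0 s).Follows 0 x) :
    ∃ y : (unravel K hK C hC).Play, s.Follows 0 y ∧ (unravelHom K hK C hC).play y = x := by
  classical
  have hlow : ∀ n, n ≤ K → n % 2 = 0 → x.pos (n + 1) = runAt hK hC (s.move n) (x.pos n) ⊥ ⊥ :=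
    fun n hn h0 => (hx n h0).trans (if_pos hn)
  have hhigh : ∀ n, K < n → n % 2 = 0 →
      x.pos (n + 1) = moveZero hK hC (s.move K) (s.move n) (x.pos n) :=
    fun n hn h0 => (hx n h0).trans ((if_neg (by omega)).trans (if_pos rfl))
  obtain ⟨a, ha_def⟩ : ∃ a, quasiAt hK hC (s.move K) (x.pos K) = a := ⟨_, rfl⟩
  have ha : IsQuasi K (x.pos (K + 1)) a := by
    rw [hlow K le_rfl hK, ← ha_def]; exact isQuasi_quasiAt hK hC s _
  have hx2 : x.pos (K + 2) ∈ a (K + 2) :=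
    ha.mem_of_pred _ le_rfl (by omega) _ (by rw [x.pred_pos]; exact ha.mem)
  have hV := isBarrier_barrier 0 (K + 2) a (exitGoal C a)
    (fun n hn => ha.pred_mem n (by omega)) (fun n hn h1 => ha.mem_of_pred n (by omega) (by omega))
  have hmove : ∀ n, K < n → n % 2 = 0 → x.pos (n + 1) =
      (if h : ∃ m, K + 2 ≤ m ∧ m ≤ n ∧ anc (x.pos n) m ∈ exitGoal C a m then
        runAt hK hC (s.move n) (x.pos n) a (cone (anc (x.pos n) (Nat.find h)))
      else if x.pos n ∈ (barrier 0 (K + 2) a (exitGoal C a)).1 n then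
        runAt hK hC (s.move n) (x.pos n) a (barrier 0 (K + 2) a (exitGoal C a)).1
      else (barrier 0 (K + 2) a (exitGoal C a)).2.move n (x.pos n)) := fun n hn h0 => by
    rw [hhigh n hn h0, moveZero, anc_pos x hn.le, ha_def]
    rfl
  generalize barrier 0 (K + 2) a (exitGoal C a) = W at hV hmove
  obtain ⟨V, τ⟩ := W
  dsimp only at hV hmove
  by_cases hex : ∃ m, K + 2 ≤ m ∧ x.pos m ∈ exitGoal C a m
  · obtain ⟨m, hm⟩ : ∃ m, Nat.find hex = m := ⟨_, rfl⟩
    obtain ⟨hmK, hm0, hma, hmC⟩ := Nat.find_spec hex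
    have hmin := fun k => Nat.find_min hex (m := k)
    rw [hm] at hmK hm0 hma hmC
    have hb : IsAnswer K C a (x.pos (K + 2)) (cone (x.pos m)) :=
      Or.inl ⟨m, x.pos m, hmK, hm0, hma, hmC, anc_pos x hmK, rfl⟩
    refine ⟨liftPlay hK hC x a _ ha hb fun n _ => pos_mem_cone x m n, fun n hn => ?_, rfl⟩
    refine liftPlay_succ hK hC ha hb _ s n ?_ ?_ (by omega)
    · rcases Nat.lt_or_ge K n with hnK | hnK
      · rcases Nat.lt_or_ge n m with hnm | hnm
        · exact move_fst_of_cone hK hC x s _ (by omega) (if_neg (by omega)) hnm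
        · have hex' : ∃ m, K + 2 ≤ m ∧ m ≤ n ∧ anc (x.pos n) m ∈ exitGoal C a m :=
            ⟨m, hmK, hnm, by rw [anc_pos x hnm]; exact ⟨hm0, hma, hmC⟩⟩
          have hfind : Nat.find hex' = m := by
            rw [Nat.find_eq_iff]
            refine ⟨⟨hmK, hnm, by rw [anc_pos x hnm]; exact ⟨hm0, hma, hmC⟩⟩, fun k hk h => ?_⟩
            rw [anc_pos x h.2.1] at h
            exact hmin k (hm ▸ hk) ⟨h.1, h.2.2⟩
          rw [hmove n hnK hn, dif_pos hex', hfind, anc_pos x hnm]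
          exact runAt_liftPlay hK hC ha hb _ s (if_neg (by omega)).symm (if_neg (by omega)).symm
      · rw [hlow n hnK hn]
        exact runAt_liftPlay hK hC ha hb _ s (if_pos (by omega)).symm (if_pos (by omega)).symm
    · rintro rfl
      exact Eq.trans (congrArg (fun q => (s.move n q).1.2.1)
        (unravel_ext hK hC (y := ⟨(x.pos n, ⊥, ⊥), isUnravelPos_bot C le_rfl _⟩) rfl
          (if_pos le_rfl) (if_pos (by omega)))) ha_def
  · push Not at hex
    have hmove' : ∀ n, K < n → n % 2 = 0 → x.pos (n + 1) =
        if x.pos n ∈ V n then runAt hK hC (s.move n) (x.pos n) a V else τ.move n (x.pos n) :=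
      fun n hn h0 => by
        rw [hmove n hn h0, dif_neg]
        rintro ⟨m, h1, h2, h3⟩
        rw [anc_pos x h2] at h3
        exact hex m h1 h3
    have hsafe : x.pos (K + 2) ∈ V (K + 2) → IsSafe K C a (x.pos (K + 2)) V := fun h => by
      refine ⟨h, fun n hn q hq => ⟨?_, hV.subset n hq⟩, hV.pred_mem, hV.mem_of_pred,
        fun n hn h1 => hV.exists_child n hn (by omega)⟩
      have hC0 : ∀ n, K + 2 ≤ n → n % 2 = 0 → ∀ q ∈ V n, q ∈ C n := fun n hn h0 q hq => by
        by_contra hqC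
        exact hV.disjoint n hn q hq ⟨h0, hV.subset n hq, hqC⟩
      rcases Nat.mod_two_eq_zero_or_one n with h0 | h1
      · exact hC0 n hn h0 q hq
      · obtain ⟨t, ht, rfl⟩ := hV.exists_child n hn (by omega) q hq
        exact hC n t (hC0 (n + 1) (by omega) (by omega) t ht)
    have hanc : ∀ n, K + 2 ≤ n → x.pos n ∈ V n → x.pos (K + 2) ∈ V (K + 2) := fun n hn => by
      induction n, hn using Nat.le_induction with
      | base => exact id
      | succ n hn ih => exact fun h => ih (by rw [← x.pred_pos]; exact hV.pred_mem n hn _ h)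
    have hall : ∀ n, K + 2 ≤ n → x.pos n ∈ V n := by
      refine hV.forall_mem x hx2 (fun n hn h0 => ⟨fun h => ?_, fun h => ?_⟩) fun n hn => hex n hn
      · have hs := hsafe (hanc n hn h)
        have hpos : IsUnravelPos K C n (x.pos n) a V :=
          ⟨fun h => by omega, fun h => by omega, fun _ => by rwa [anc_pos x (by omega)],
            fun _ => by rw [anc_pos x (by omega)]; exact Or.inr hs, fun _ => h⟩
        rw [hmove' n (by omega) h0, if_pos h]
        rw [runAt, dif_pos hpos]
        exact hV.subset _ (unravel_move_mem s ⟨(x.pos n, a, V), hpos⟩ (by omega))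
      · rw [hmove' n (by omega) h0, if_neg h]
    have hb : IsAnswer K C a (x.pos (K + 2)) V := Or.inr (hsafe (hall _ le_rfl))
    refine ⟨liftPlay hK hC x a V ha hb hall, fun n hn => ?_, rfl⟩
    refine liftPlay_succ hK hC ha hb _ s n ?_ ?_ (by omega)
    · rcases Nat.lt_or_ge K n with hnK | hnK
      · rw [hmove' n hnK hn, if_pos (hall n (by omega))]
        exact runAt_liftPlay hK hC ha hb _ s (if_neg (by omega)).symm (if_neg (by omega)).symm
      · rw [hlow n hnK hn]
        exact runAt_liftPlay hK hC ha hb _ s (if_pos (by omega)).symm (if_pos (by omega)).symm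
    · rintro rfl
      exact Eq.trans (congrArg (fun q => (s.move n q).1.2.1)
        (unravel_ext hK hC (y := ⟨(x.pos n, ⊥, ⊥), isUnravelPos_bot C le_rfl _⟩) rfl
          (if_pos le_rfl) (if_pos (by omega)))) ha_def

theorem exists_lift_one (s : (unravel K hK C hC).Strategy) (x : T.Play)
    (hx : (unravelStrat hK hC 1 s).Follows 1 x) :
    ∃ y : (unravel K hK C hC).Play, s.Follows 1 y ∧ (unravelHom K hK C hC).play y = x := by
  classical
  have hlow : ∀ n, n ≤ K → n % 2 = 1 → x.pos (n + 1) = runAt hK hC (s.move n) (x.pos n) ⊥ ⊥ :=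
    fun n hn h0 => (hx n h0).trans (if_pos hn)
  have hhigh : ∀ n, K < n → n % 2 = 1 →
      x.pos (n + 1) = moveOne hK hC (s.move (K + 1)) (s.move n) (x.pos n) :=
    fun n hn h0 => (hx n h0).trans ((if_neg (by omega)).trans (if_neg (by omega)))
  let U := replyGoal hK hC (s.move (K + 1)) (x.pos (K + 1))
  have hV := isBarrier_barrier 1 (K + 1) (fun _ => Set.univ) U
    (fun n hn _ _ => trivial) (fun n hn h1 _ _ => trivial)
  have hmove : ∀ n, K < n → n % 2 = 1 → x.pos (n + 1) =
      (if h : ∃ m, K + 2 ≤ m ∧ m ≤ n ∧ anc (x.pos n) m ∈ U m then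
        runAt hK hC (s.move n) (x.pos n) (Nat.find_spec h).2.2.choose
          (cone (anc (x.pos n) (Nat.find h)))
      else if x.pos n ∈ (barrier 1 (K + 1) (fun _ => Set.univ) U).1 n then
        runAt hK hC (s.move n) (x.pos n) (barrier 1 (K + 1) (fun _ => Set.univ) U).1
          (if n ≤ K + 1 then ⊥ else answerAt hK hC (s.move (K + 1)) (x.pos (K + 1))
            (barrier 1 (K + 1) (fun _ => Set.univ) U).1)
      else (barrier 1 (K + 1) (fun _ => Set.univ) U).2.move n (x.pos n)) := fun n hn h0 => by
    rw [hhigh n hn h0, moveOne, anc_pos x (Nat.succ_le_of_lt hn)]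
    rfl
  generalize barrier 1 (K + 1) (fun _ => Set.univ) U = W at hV hmove
  obtain ⟨V, τ⟩ := W
  dsimp only at hV hmove
  by_cases hex : ∃ m, K + 2 ≤ m ∧ x.pos m ∈ U m
  · obtain ⟨m, hm⟩ : ∃ m, Nat.find hex = m := ⟨_, rfl⟩
    obtain ⟨hmK, hmU⟩ := Nat.find_spec hex
    have hmin := fun k => Nat.find_min hex (m := k)
    rw [hm] at hmK hmU
    obtain ⟨a, hadef⟩ : ∃ a, hmU.choose = a := ⟨_, rfl⟩
    have hr : IsReply hK hC (s.move (K + 1)) (x.pos (K + 1)) (x.pos m) a :=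
      hadef ▸ hmU.choose_spec
    have ha := hr.isQuasi
    have hb : IsAnswer K C a (x.pos (K + 2)) (cone (x.pos m)) :=
      Or.inl ⟨m, x.pos m, hmK, hr.even, hr.mem, hr.notMem, anc_pos x hmK, rfl⟩
    have hpos : (liftPlay hK hC x a _ ha hb fun n _ => pos_mem_cone x m n).pos (K + 1) =
        ⟨(x.pos (K + 1), a, ⊥), .of_isQuasi C ha⟩ :=
      unravel_ext hK hC rfl (if_neg (by omega)) (if_pos le_rfl)
    refine ⟨liftPlay hK hC x a _ ha hb fun n _ => pos_mem_cone x m n, fun n hn => ?_, rfl⟩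
    refine liftPlay_succ hK hC ha hb _ s n ?_ (by omega) ?_
    · rcases Nat.lt_or_ge K n with hnK | hnK
      · rcases Nat.lt_or_ge n m with hnm | hnm
        · rcases (Nat.succ_le_of_lt hnK).eq_or_lt with rfl | hnK1
          · rw [hpos]
            exact hr.fst_eq.trans (anc_pos x hmK)
          · exact move_fst_of_cone hK hC x s _ (by omega) (if_neg (by omega)) hnm
        · have hanc : anc (x.pos n) m ∈ U m := by rwa [anc_pos x hnm]
          have hex' : ∃ m, K + 2 ≤ m ∧ m ≤ n ∧ anc (x.pos n) m ∈ U m := ⟨m, hmK, hnm, hanc⟩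
          have hfind : Nat.find hex' = m := by
            rw [Nat.find_eq_iff]
            refine ⟨⟨hmK, hnm, hanc⟩, fun k hk h => ?_⟩
            rw [anc_pos x h.2.1] at h
            exact hmin k (hm ▸ hk) ⟨h.1, h.2.2⟩
          have hchoose : (Nat.find_spec hex').2.2.choose = a := by
            rw [← hadef]
            congr 1
            rw [hfind, anc_pos x hnm]
          rw [hmove n hnK hn, dif_pos hex', hchoose, hfind, anc_pos x hnm]
          exact runAt_liftPlay hK hC ha hb _ s (if_neg (by omega)).symm (if_neg (by omega)).symm
      · rw [hlow n hnK hn]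
        exact runAt_liftPlay hK hC ha hb _ s (if_pos (by omega)).symm (if_pos (by omega)).symm
    · rintro rfl
      rw [hpos]
      exact hr.snd_eq
  · push Not at hex
    have hmove' : ∀ n, K < n → n % 2 = 1 → x.pos (n + 1) =
        if x.pos n ∈ V n then runAt hK hC (s.move n) (x.pos n) V
          (if n ≤ K + 1 then ⊥ else answerAt hK hC (s.move (K + 1)) (x.pos (K + 1)) V)
        else τ.move n (x.pos n) :=
      fun n hn h0 => by
        rw [hmove n hn h0, dif_neg]
        rintro ⟨m, h1, h2, h3⟩
        rw [anc_pos x h2] at h3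
        exact hex m h1 h3
    have hUlow : ∀ p : T.Pos (K + 1), p ∉ U (K + 1) := by
      rintro p ⟨a, h⟩
      have := h.even
      omega
    have hVall : ∀ n, K + 1 ≤ n → x.pos n ∈ V n := by
      refine hV.forall_mem x trivial (fun n hn h1 => ⟨fun _ => trivial, fun h => ?_⟩)
        fun n hn => ?_
      · rw [hmove' n hn h1, if_neg h]
      · rcases hn.eq_or_lt with rfl | hn
        · exact hUlow _
        · exact hex n hn
    have ha : IsQuasi K (x.pos (K + 1)) V :=
      ⟨hVall _ le_rfl, hV.pred_mem, fun n hn h1 q => hV.mem_of_pred n hn h1 q trivial,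
        fun n hn h0 => hV.exists_child n hn (by omega)⟩
    obtain ⟨z, hz⟩ : ∃ z, s.move (K + 1) ⟨(x.pos (K + 1), V, ⊥), .of_isQuasi C ha⟩ = z := ⟨_, rfl⟩
    have hans : answerAt hK hC (s.move (K + 1)) (x.pos (K + 1)) V = z.1.2.2 := by
      rw [answerAt, dif_pos ha, hz]
    have hz1 : z.1.1 = x.pos (K + 2) := by
      rw [hmove' (K + 1) (by omega) (by omega), if_pos (hVall _ le_rfl), if_pos le_rfl, runAt,
        dif_pos (.of_isQuasi C ha), hz]
    have hz2 : z.1.2.1 = V := by rw [← hz]; exact unravel_move_quasi s _ (by omega)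
    have hb : IsAnswer K C V (x.pos (K + 2)) z.1.2.2 := by
      have := z.2.isAnswer (by omega)
      rwa [anc_self, hz1, hz2] at this
    have hsafe : IsSafe K C V (x.pos (K + 2)) z.1.2.2 := by
      rcases hb with ⟨m, u, hm, h0, huV, huC, hu, hcone⟩ | h
      · exact absurd ⟨V, ha, h0, huV, huC, by rw [hz, hz1, hu], by rw [hz, hcone]⟩
          (hV.disjoint m (by omega) u huV)
      · exact h
    have hmem : ∀ n, K + 2 ≤ n → x.pos n ∈ z.1.2.2 n := fun n hn => by
      induction n, hn using Nat.le_induction with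
      | base => exact hsafe.mem
      | succ n hn ih =>
        rcases Nat.mod_two_eq_zero_or_one n with h0 | h1
        · exact hsafe.mem_of_pred n hn h0 _ (hVall _ (by omega)) (by rwa [x.pred_pos])
        · have hpos : IsUnravelPos K C n (x.pos n) V z.1.2.2 :=
            ⟨fun h => by omega, fun h => by omega, fun _ => by rwa [anc_pos x (by omega)],
              fun _ => by rw [anc_pos x (by omega)]; exact hb, fun _ => ih⟩
          rw [hmove' n (by omega) h1, if_pos (hVall n (by omega)), if_neg (by omega), hans, runAt,
            dif_pos hpos]
          exact unravel_move_mem s ⟨(x.pos n, V, z.1.2.2), hpos⟩ (by omega)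
    have hpos : (liftPlay hK hC x V _ ha hb hmem).pos (K + 1) =
        ⟨(x.pos (K + 1), V, ⊥), .of_isQuasi C ha⟩ :=
      unravel_ext hK hC rfl (if_neg (by omega)) (if_pos le_rfl)
    refine ⟨liftPlay hK hC x V _ ha hb hmem, fun n hn => ?_, rfl⟩
    refine liftPlay_succ hK hC ha hb _ s n ?_ (by omega) ?_
    · rcases Nat.lt_or_ge K n with hnK | hnK
      · rw [hmove' n hnK hn, if_pos (hVall n (by omega)), hans]
        exact runAt_liftPlay hK hC ha hb _ s (if_neg (by omega)).symm rfl
      · rw [hlow n hnK hn]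
        exact runAt_liftPlay hK hC ha hb _ s (if_pos (by omega)).symm (if_pos (by omega)).symm
    · rintro rfl
      rw [hpos, hz]

theorem unravelHom_bijective {n : ℕ} (hn : n ≤ K) :
    Function.Bijective ((unravelHom K hK C hC).map n) := by
  refine ⟨fun x y h => unravel_ext hK hC h ?_ ?_,
    fun p => ⟨⟨(p, ⊥, ⊥), isUnravelPos_bot C hn p⟩, rfl⟩⟩
  · rw [x.2.fst_eq hn, y.2.fst_eq hn]
  · rw [x.2.snd_eq (by omega), y.2.snd_eq (by omega)]

/-- The covering of `T` by the unraveled tree. -/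
noncomputable def unravelCovering : Covering K (unravel K hK C hC) T where
  toHom := unravelHom K hK C hC
  strat := unravelStrat hK hC
  strat_congr := unravelStrat_congr hK hC
  exists_lift j s x hj hx := by
    rcases (by omega : j = 0 ∨ j = 1) with rfl | rfl
    · exact exists_lift_zero hK hC s x hx
    · exact exists_lift_one hK hC s x hx
  bijective n hn := unravelHom_bijective hK hC hn
  strat_map j s n p hn := by
    refine (if_pos hn.le).trans ?_
    have := runAt_eq hK hC (s.move n) p
    rwa [p.2.fst_eq hn.le, p.2.snd_eq (by omega)] at this

theorem isDecided_unravel :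
    IsDecided ((unravelHom K hK C hC).play ⁻¹' {x | ∀ n, x.pos n ∈ C n}) := by
  intro x
  have main : ∀ x : (unravel K hK C hC).Play,
      ((unravelHom K hK C hC).play x ∈ {x : T.Play | ∀ n, x.pos n ∈ C n}) ↔
        ∀ n (q : T.Pos n), K + 2 ≤ n → q ∈ (x.pos (K + 2)).1.2.2 n → q ∈ C n := by
    intro x
    have hb : ∀ n, K + 2 ≤ n → (x.pos n).1.2.2 = (x.pos (K + 2)).1.2.2 := fun n hn => by
      induction n, hn using Nat.le_induction with
      | base => rfl
      | succ n hn ih =>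
        rw [← ih, ← x.pred_pos n]
        exact (if_neg (by omega)).symm
    have hmem : ∀ n, K + 2 ≤ n → (x.pos n).1.1 ∈ (x.pos (K + 2)).1.2.2 n := fun n hn => by
      rw [← hb n hn]; exact (x.pos n).2.mem (by omega)
    constructor
    · intro h n q hn hq
      rcases (x.pos (K + 2)).2.isAnswer (by omega) with ⟨m, u, hm, -, -, huC, -, hcone⟩ | hs
      · have := hmem m hm
        rw [hcone] at this
        have h2 := eq_of_mem_cone this le_rfl
        rw [anc_self] at h2
        exact absurd (h2 ▸ h m) huC
      · exact (hs.subset n hn q hq).1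
    · intro h
      have h1 : ∀ n, K + 2 ≤ n → (x.pos n).1.1 ∈ C n := fun n hn => h n _ hn (hmem n hn)
      intro n
      rcases le_total (K + 2) n with hn | hn
      · exact h1 n hn
      · refine Nat.decreasingInduction' (P := fun n => (x.pos n).1.1 ∈ C n) (fun k _ _ ih => ?_) hn
          (h1 _ le_rfl)
        have := hC k _ ih
        rwa [show T.pred k (x.pos (k + 1)).1.1 = (x.pos k).1.1 from
          congrArg (fun y => y.1.1) (x.pred_pos k)] at this
  refine ⟨K + 2, fun y hy => ?_⟩
  rw [Set.mem_preimage, Set.mem_preimage, main x, main y, hy]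

end Unravel

end GameTree

namespace GameTree

variable {T : GameTree}

/-! ### Borel determinacy -/

theorem IsDecided.compl {A : Set T.Play} (hA : IsDecided A) : IsDecided Aᶜ := fun x => by
  obtain ⟨n, hn⟩ := hA x
  exact ⟨n, fun y hy => not_congr (hn y hy)⟩

/-- A set of plays is unravelable if its pullback to every tree over `T` becomes decided after
passing to a covering. -/
def IsUnravelable (A : Set T.Play) : Prop :=
  ∀ (S : GameTree) (f : Hom S T) (K : ℕ), ∃ (R : GameTree) (c : Covering K R S),
    IsDecided ((f.comp c.toHom).play ⁻¹' A)

theorem IsDecided.isUnravelable {A : Set T.Play} (hA : IsDecided A) : IsUnravelable A :=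
  fun S _ K => ⟨S, .refl K S, hA.preimage _⟩

theorem IsUnravelable.compl {A : Set T.Play} (hA : IsUnravelable A) : IsUnravelable Aᶜ :=
  fun S f K => by
    obtain ⟨R, c, h⟩ := hA S f K
    exact ⟨R, c, h.compl⟩

theorem isUnravelable_closed (C : T.Sub) (hC : ∀ n, ∀ q ∈ C (n + 1), T.pred n q ∈ C n) :
    IsUnravelable {x : T.Play | ∀ n, x.pos n ∈ C n} := fun S f K => by
  have hC' : ∀ n, ∀ q ∈ f.map (n + 1) ⁻¹' C (n + 1), S.pred n q ∈ f.map n ⁻¹' C n :=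
    fun n q hq => by
      have := hC n _ hq
      rwa [f.pred_map] at this
  have hK : (2 * K) % 2 = 0 := by omega
  exact ⟨_, (unravelCovering (C := fun n => f.map n ⁻¹' C n) hK hC').weaken (by omega),
    isDecided_unravel hK hC'⟩

theorem isUnravelable_iUnion_of_isDecided {B : ℕ → Set T.Play} (hB : ∀ i, IsDecided (B i)) :
    IsUnravelable (⋃ i, B i) := by
  have h := isUnravelable_closed (T := T) (fun n => {p | ∃ y : T.Play, y.pos n = p ∧ y ∉ ⋃ i, B i})
    (by rintro n _ ⟨y, rfl, hy⟩; exact ⟨y, (y.pred_pos n).symm, hy⟩)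
  have heq : {x : T.Play | ∀ n, x.pos n ∈
      {p | ∃ y : T.Play, y.pos n = p ∧ y ∉ ⋃ i, B i}} = (⋃ i, B i)ᶜ := by
    refine Set.Subset.antisymm (fun x hx hxB => ?_) fun x hx n => ⟨x, rfl, hx⟩
    obtain ⟨i, hi⟩ := Set.mem_iUnion.1 hxB
    obtain ⟨n, hn⟩ := hB i x
    obtain ⟨y, hy, hyB⟩ := hx n
    exact hyB (Set.mem_iUnion.2 ⟨i, (hn y hy).2 hi⟩)
  rw [heq] at h
  simpa using h.compl

theorem IsUnravelable.iUnion {A : ℕ → Set T.Play} (hA : ∀ i, IsUnravelable (A i)) :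
    IsUnravelable (⋃ i, A i) := fun S f K => by
  choose R c hc using hA
  let X : ℕ → Σ S : GameTree, Hom S T := fun i => Nat.rec ⟨S, f⟩
    (fun i X => ⟨R i X.1 X.2 (K + i), X.2.comp (c i X.1 X.2 (K + i)).toHom⟩) i
  let Y : ℕ → GameTree := fun i => (X i).1
  let d : ∀ i, Covering (K + i) (Y (i + 1)) (Y i) := fun i => c i (X i).1 (X i).2 (K + i)
  have hproj : ∀ i, (X i).2.comp (limitProj d i) = f.comp (limitCovering d).toHom := fun i => by
    induction i with
    | zero => rfl
    | succ i ih =>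
      rw [← ih]
      show Hom.mk _ _ = Hom.mk _ _
      congr 1
      funext n p
      exact congrArg ((X i).2.map n) (p.2 i)
  have hdec : ∀ i, IsDecided ((f.comp (limitCovering d).toHom).play ⁻¹' A i) := fun i => by
    rw [← hproj (i + 1)]
    exact IsDecided.preimage (limitProj d (i + 1)) (hc i (X i).1 (X i).2 (K + i))
  obtain ⟨Q, e, he⟩ :=
    isUnravelable_iUnion_of_isDecided hdec (limit d) ⟨fun _ p => p, fun _ _ => rfl⟩ K
  refine ⟨Q, (limitCovering d).comp e, ?_⟩
  rw [← Set.preimage_iUnion] at he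
  exact he

/-- The `σ`-algebra of unravelable sets of plays. -/
abbrev unravelableSpace (T : GameTree) : MeasurableSpace T.Play where
  MeasurableSet' := IsUnravelable
  measurableSet_empty := IsDecided.isUnravelable fun _ => ⟨0, fun _ _ => Iff.rfl⟩
  measurableSet_compl _ h := h.compl
  measurableSet_iUnion _ h := .iUnion h

/-- **Borel determinacy** (Martin). -/
theorem IsUnravelable.determined [Subsingleton (T.Pos 0)] {A : Set T.Play}
    (hA : IsUnravelable A) :
    (∃ s : T.Strategy, ∀ x, s.Follows 0 x → x ∈ A) ∨
      ∃ s : T.Strategy, ∀ x, s.Follows 1 x → x ∉ A := by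
  obtain ⟨R, c, hc⟩ := hA T ⟨fun _ p => p, fun _ _ => rfl⟩ 0
  have : Subsingleton (R.Pos 0) := (c.bijective 0 le_rfl).1.subsingleton
  rcases exists_winning_of_isDecided hc with ⟨s, hs⟩ | ⟨s, hs⟩
  · refine Or.inl ⟨c.strat 0 s, fun x hx => ?_⟩
    obtain ⟨y, hy, rfl⟩ := c.exists_lift 0 s x (by omega) hx
    exact hs y hy
  · refine Or.inr ⟨c.strat 1 s, fun x hx => ?_⟩
    obtain ⟨y, hy, rfl⟩ := c.exists_lift 1 s x (by omega) hx
    exact hs y hy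

end GameTree

/-! ### Words in involutive letters -/

namespace InvolutiveWord

variable {α L : Type}

/-- Translation of a labelling of words. -/
def act (w : List α) (x : List α → L) : List α → L := fun v => x (w ++ v)

theorem act_act (u v : List α) (x : List α → L) : act v (act u x) = act (u ++ v) x :=
  funext fun w => congrArg x (List.append_assoc u v w).symm

variable [DecidableEq α]

/-- Left multiplication of a reduced word by a letter. -/
def push (i : α) : List α → List α
  | [] => [i]
  | j :: t => if i = j then t else i :: j :: t

/-- The reduced form of a word. -/
def red (w : List α) : List α := w.foldr push []

/-- Words without two equal consecutive letters. -/
abbrev IsRed (w : List α) : Prop := w.IsChain (· ≠ ·)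

theorem IsRed.push {i : α} {w : List α} (h : IsRed w) : IsRed (push i w) := by
  cases w with
  | nil => simp [InvolutiveWord.push]
  | cons j t =>
    rw [InvolutiveWord.push]
    split_ifs with hij
    · exact h.tail
    · exact List.isChain_cons_cons.2 ⟨hij, h⟩

theorem push_push {i : α} {w : List α} (h : IsRed w) : push i (push i w) = w := by
  cases w with
  | nil => simp [push]
  | cons j t =>
    by_cases hij : i = j
    · subst hij
      cases t with
      | nil => simp [push]
      | cons k t => simp [push, (List.isChain_cons_cons.1 h).1]
    · simp [push, hij]

theorem push_of_isRed {i : α} {w : List α} (h : IsRed (i :: w)) : push i w = i :: w := by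
  cases w with
  | nil => rfl
  | cons k t => simp [push, (List.isChain_cons_cons.1 h).1]

@[simp] theorem red_nil : red ([] : List α) = [] := rfl

theorem red_cons (i : α) (w : List α) : red (i :: w) = push i (red w) := rfl

theorem isRed_red (w : List α) : IsRed (red w) := by
  induction w with
  | nil => exact List.isChain_nil
  | cons i w ih => exact ih.push

theorem red_of_isRed {w : List α} (h : IsRed w) : red w = w := by
  induction w with
  | nil => rfl
  | cons i w ih => rw [red_cons, ih h.tail, push_of_isRed h]

theorem red_append (u v : List α) : red (u ++ v) = u.foldr push (red v) := by
  rw [red, List.foldr_append]; rfl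

theorem red_append_congr (u : List α) {v v' : List α} (h : red v = red v') :
    red (u ++ v) = red (u ++ v') := by
  rw [red_append, red_append, h]

@[simp] theorem red_red (w : List α) : red (red w) = red w := red_of_isRed (isRed_red w)

theorem foldr_push_push (i : α) (u w : List α) (hw : IsRed w) :
    (push i u).foldr push w = push i (u.foldr push w) := by
  have hf : ∀ u : List α, IsRed (u.foldr push w) := fun u => by
    induction u with
    | nil => exact hw
    | cons j u ih => exact ih.push
  cases u with
  | nil => rfl
  | cons j u =>
    by_cases hij : i = j
    · subst hij
      rw [List.foldr_cons, push_push (hf u)]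
      simp [push]
    · simp [push, hij]

theorem red_red_append (u v : List α) : red (red u ++ v) = red (u ++ v) := by
  rw [red_append, red_append]
  induction u with
  | nil => rfl
  | cons i u ih => rw [red_cons, foldr_push_push i _ _ (isRed_red v), ih]; rfl

theorem red_append_congr_left {u u' : List α} (v : List α) (h : red u = red u') :
    red (u ++ v) = red (u' ++ v) := by
  rw [← red_red_append u, h, red_red_append]

theorem red_cons_cons (i : α) (w : List α) : red (i :: i :: w) = red w :=
  push_push (isRed_red w)

theorem red_append_cons_cons (u : List α) (i : α) (w : List α) :
    red (u ++ i :: i :: w) = red (u ++ w) :=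
  red_append_congr u (red_cons_cons i w)

theorem red_append_reverse_append (u v : List α) : red (u ++ (u.reverse ++ v)) = red v := by
  induction u generalizing v with
  | nil => rfl
  | cons i u ih =>
    have : i :: u ++ ((i :: u).reverse ++ v) = i :: (u ++ (u.reverse ++ (i :: v))) := by simp
    rw [this, red_cons, ih]
    exact red_cons_cons i v

theorem length_push_mod_two (i : α) (w : List α) : (push i w).length % 2 = (w.length + 1) % 2 := by
  cases w with
  | nil => rfl
  | cons j t =>
    rw [push]
    split_ifs
    · simp only [List.length_cons]; omega
    · simp

theorem length_red_mod_two (w : List α) : (red w).length % 2 = w.length % 2 := by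
  induction w with
  | nil => rfl
  | cons i w ih => rw [red_cons, length_push_mod_two, List.length_cons]; omega

/-- Two words differing by a letter on the right start, once reduced, with the same letter,
unless one of them is trivial. -/
theorem exists_head (u : List α) (j : α) : ∃ i,
    (red u = [] ∨ (red u).head? = some i) ∧
      (red (u ++ [j]) = [] ∨ (red (u ++ [j])).head? = some i) := by
  have hfold : ∀ w : List α, IsRed w → w.foldr push [j] = w ++ [j] ∨
      ∃ t, w = t ++ [j] ∧ w.foldr push [j] = t := by
    intro w hw
    induction w with
    | nil => exact Or.inl rfl
    | cons i w ih =>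
      rcases ih hw.tail with h | ⟨t, rfl, h⟩
      · rw [List.foldr_cons, h]
        cases w with
        | nil =>
          by_cases hij : i = j
          · exact Or.inr ⟨[], by simp [hij], by simp [push, hij]⟩
          · exact Or.inl (by simp [push, hij])
        | cons k w => exact Or.inl (by simp [push, (List.isChain_cons_cons.1 hw).1])
      · refine Or.inr ⟨i :: t, rfl, ?_⟩
        rw [List.foldr_cons, h]
        cases t with
        | nil => rfl
        | cons k t =>
          have := (List.isChain_cons_cons.1 hw).1
          simp [push, this]
  have hred : red (u ++ [j]) = (red u).foldr push [j] := by
    rw [← red_red_append, red_append]; rfl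
  rw [hred]
  rcases hfold _ (isRed_red u) with h | ⟨t, h1, h2⟩
  · rw [h]
    cases red u with
    | nil => exact ⟨j, Or.inl rfl, Or.inr rfl⟩
    | cons i t => exact ⟨i, Or.inr rfl, Or.inr rfl⟩
  · rw [h2, h1]
    cases t with
    | nil => exact ⟨j, Or.inr rfl, Or.inl rfl⟩
    | cons i t => exact ⟨i, Or.inr rfl, Or.inr rfl⟩

/-! ### Labellings -/

/-- Proper labellings of the tree of reduced words. -/
def properLabellings (α L : Type) [DecidableEq α] : Set (List α → L) :=
  {x | (∀ w, x (red w) = x w) ∧ ∀ u j, x (u ++ [j]) ≠ x u}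

section Proper

variable {x : List α → L} (hx : x ∈ properLabellings α L)

include hx

theorem eq_of_red_eq {u v : List α} (h : red u = red v) : x u = x v := by
  rw [← hx.1 u, h, hx.1]

theorem act_congr {u v : List α} (h : red u = red v) : act u x = act v x :=
  funext fun w => eq_of_red_eq hx (red_append_congr_left w h)

theorem act_mem (w : List α) : act w x ∈ properLabellings α L := by
  refine ⟨fun v => eq_of_red_eq hx (red_append_congr w (red_red v)), fun u j => ?_⟩
  show x (w ++ (u ++ [j])) ≠ x (w ++ u)
  rw [← List.append_assoc]
  exact hx.2 _ _

theorem act_cons_act (i : α) (w : List α) : act (i :: w) (act [i] x) = act w x := by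
  rw [act_act]
  exact act_congr hx (red_cons_cons i w)

theorem act_act_self (i : α) : act [i] (act [i] x) = x := act_cons_act hx i []

end Proper

end InvolutiveWord

/-! ### Games revealing a labelling -/

namespace RevealGame

variable {W L : Type}

/-- Membership in the set of labellings is determined by finitely many coordinates at a time. -/
def FinitelyClosed (Ω : Set (W → L)) : Prop :=
  ∀ y, (∀ F : Finset W, ∃ x ∈ Ω, ∀ w ∈ F, x w = y w) → y ∈ Ω

theorem FinitelyClosed.exists_limit {Ω : Set (W → L)} (hΩ : FinitelyClosed Ω) {E : ℕ → Set W}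
    (hE : Monotone E) (hE' : ∀ w, ∃ k, w ∈ E k) {x : ℕ → W → L} (hx : ∀ k, x k ∈ Ω)
    (h : ∀ k, ∀ w ∈ E k, x (k + 1) w = x k w) : ∃ y ∈ Ω, ∀ k, ∀ w ∈ E k, y w = x k w := by
  choose r hr using hE'
  have hle : ∀ j k, j ≤ k → ∀ w ∈ E j, x k w = x j w := by
    intro j k hjk w hw
    induction k, hjk using Nat.le_induction with
    | base => rfl
    | succ k hjk ih => rw [h k w (hE hjk hw), ih]
  refine ⟨fun w => x (r w) w, hΩ _ fun F => ?_, fun k w hw => ?_⟩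
  · exact ⟨x (F.sup r), hx _, fun w hw => hle _ _ (Finset.le_sup hw) _ (hr w)⟩
  · rcases le_total k (r w) with h' | h'
    · exact hle _ _ h' _ hw
    · exact (hle _ _ h' _ (hr w)).symm

/-- A way of extending, at stage `n`, the partial labelling revealed on `D n`. -/
structure IsResponse (Ω : Set (W → L)) (D : ℕ → Set W) (σ : ℕ → (W → L) → W → L) : Prop where
  mem : ∀ n, ∀ x ∈ Ω, σ n x ∈ Ω
  agree : ∀ n, ∀ x ∈ Ω, ∀ w ∈ D n, σ n x w = x w
  congr : ∀ n, ∀ x ∈ Ω, ∀ y ∈ Ω, (∀ w ∈ D n, x w = y w) → σ n x = σ n y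

/-- At the stages of parity `j` the labelling is extended according to the response. -/
def Consistent (D : ℕ → Set W) (σ : ℕ → (W → L) → W → L) (j : ℕ) (x : W → L) : Prop :=
  ∀ n, n % 2 = j → ∀ w ∈ D (n + 1), x w = σ n x w

open Classical in
/-- Forget a labelling outside a set. -/
noncomputable def trunc [Inhabited L] (D : Set W) (x : W → L) : W → L :=
  fun w => if w ∈ D then x w else default

theorem trunc_apply [Inhabited L] {D : Set W} {x : W → L} {w : W} (h : w ∈ D) :
    trunc D x w = x w := if_pos h

theorem trunc_congr [Inhabited L] {D : Set W} {x y : W → L} (h : ∀ w ∈ D, x w = y w) :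
    trunc D x = trunc D y := by
  funext w
  unfold trunc
  split_ifs with hw
  · exact h w hw
  · rfl

theorem trunc_trunc [Inhabited L] {D D' : Set W} (h : D ⊆ D') (x : W → L) :
    trunc D (trunc D' x) = trunc D x :=
  trunc_congr fun _ hw => trunc_apply (h hw)

/-- The game in which the restriction of a labelling to `D n` is revealed at stage `n`. -/
noncomputable def tree [Inhabited L] (Ω : Set (W → L)) (D : ℕ → Set W) (hD : Monotone D) :
    GameTree where
  Pos n := {f : W → L // ∃ x ∈ Ω, f = trunc (D n) x}
  pred n f := ⟨trunc (D n) f.1, by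
    obtain ⟨f, x, hx, rfl⟩ := f
    exact ⟨x, hx, trunc_trunc (hD n.le_succ) x⟩⟩
  pred_surj n := by
    rintro ⟨f, x, hx, rfl⟩
    exact ⟨⟨_, x, hx, rfl⟩, Subtype.ext (trunc_trunc (hD n.le_succ) x)⟩

section

variable [Inhabited L] {Ω : Set (W → L)} {D : ℕ → Set W} {hD : Monotone D}

/-- The play revealing a given labelling. -/
noncomputable def play (hD : Monotone D) (x : W → L) (hx : x ∈ Ω) : (tree Ω D hD).Play where
  pos n := ⟨trunc (D n) x, x, hx, rfl⟩
  pred_pos n := Subtype.ext (trunc_trunc (hD n.le_succ) x)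

theorem exists_response (s : (tree Ω D hD).Strategy) : ∃ σ, IsResponse Ω D σ ∧
    ∀ j x (hx : x ∈ Ω), Consistent D σ j x → s.Follows j (play hD x hx) := by
  classical
  choose e he he' using fun n (x : W → L) (hx : x ∈ Ω) =>
    (s.move n ⟨trunc (D n) x, x, hx, rfl⟩).2
  let σ : ℕ → (W → L) → W → L := fun n x =>
    if h : ∃ y ∈ Ω, ∀ w ∈ D n, x w = y w then
      ((s.move n ⟨trunc (D n) x, h.choose, h.choose_spec.1, trunc_congr h.choose_spec.2⟩).2).choose
    else x
  have hσ : ∀ n x (hx : x ∈ Ω), σ n x ∈ Ω ∧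
      (s.move n ⟨trunc (D n) x, x, hx, rfl⟩).1 = trunc (D (n + 1)) (σ n x) := by
    intro n x hx
    have h : ∃ y ∈ Ω, ∀ w ∈ D n, x w = y w := ⟨x, hx, fun _ _ => rfl⟩
    have h1 : σ n x = ((s.move n ⟨trunc (D n) x, x, hx, rfl⟩).2).choose := dif_pos h
    rw [h1]
    exact ((s.move n ⟨trunc (D n) x, x, hx, rfl⟩).2).choose_spec
  refine ⟨σ, ⟨fun n x hx => (hσ n x hx).1, fun n x hx w hw => ?_, fun n x hx y hy hxy => ?_⟩, ?_⟩
  · have h1 := congrArg Subtype.val (s.pred_move n ⟨trunc (D n) x, x, hx, rfl⟩)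
    change trunc (D n) (s.move n _).1 = trunc (D n) x at h1
    rw [(hσ n x hx).2, trunc_trunc (hD n.le_succ)] at h1
    have h2 := congrFun h1 w
    rwa [trunc_apply hw, trunc_apply hw] at h2
  · have h1 : ∀ z (hz : z ∈ Ω),
        σ n z = ((s.move n ⟨trunc (D n) z, z, hz, rfl⟩).2).choose := fun z hz =>
      dif_pos ⟨z, hz, fun _ _ => rfl⟩
    rw [h1 x hx, h1 y hy]
    have h2 : (⟨trunc (D n) x, x, hx, rfl⟩ : (tree Ω D hD).Pos n) =
        ⟨trunc (D n) y, y, hy, rfl⟩ := Subtype.ext (trunc_congr hxy)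
    generalize (⟨trunc (D n) x, x, hx, rfl⟩ : (tree Ω D hD).Pos n) = p at h2
    subst h2
    rfl
  · intro j x hx hc n hn
    apply Subtype.ext
    rw [show ((play hD x hx).pos n) = ⟨trunc (D n) x, x, hx, rfl⟩ from rfl, (hσ n x hx).2]
    exact trunc_congr (hc n hn)

/-- Borel determinacy for the games revealing a labelling. -/
theorem determined [Countable W] [Countable L] [MeasurableSpace L] [MeasurableSingletonClass L]
    (hD : Monotone D) (hD' : ∀ w, ∃ n, w ∈ D n)
    (h0 : ∀ x ∈ Ω, ∀ y ∈ Ω, ∀ w ∈ D 0, x w = y w) {A : Set (W → L)} (hA : MeasurableSet A) :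
    (∃ σ, IsResponse Ω D σ ∧ ∀ x ∈ Ω, Consistent D σ 0 x → x ∈ A) ∨
      ∃ σ, IsResponse Ω D σ ∧ ∀ x ∈ Ω, Consistent D σ 1 x → x ∉ A := by
  choose r hr using hD'
  let T := tree Ω D hD
  let lab : T.Play → W → L := fun p w => (p.pos (r w)).1 w
  have hlab : ∀ x (hx : x ∈ Ω), lab (play hD x hx) = x := fun x hx =>
    funext fun w => trunc_apply (hr w)
  let _ : MeasurableSpace T.Play := T.unravelableSpace
  have hm : Measurable lab := by
    refine measurable_pi_iff.2 fun w => measurable_to_countable' fun a => ?_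
    refine GameTree.IsDecided.isUnravelable fun p => ⟨r w, fun q hq => ?_⟩
    have : lab q w = lab p w := by simp only [lab, hq]
    simp [this]
  have : Subsingleton (T.Pos 0) := ⟨by
    rintro ⟨_, x, hx, rfl⟩ ⟨_, y, hy, rfl⟩
    exact Subtype.ext (trunc_congr (h0 x hx y hy))⟩
  have hA' : GameTree.IsUnravelable (lab ⁻¹' A) := hm hA
  refine hA'.determined.imp ?_ ?_ <;>
  · rintro ⟨s, hs⟩
    obtain ⟨σ, hσ, hσ'⟩ := exists_response s
    refine ⟨σ, hσ, fun x hx hc => ?_⟩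
    have := hs _ (hσ' _ x hx hc)
    rwa [Set.mem_preimage, hlab] at this

end

end RevealGame

/-! ### Alternating choices along a tree -/

namespace InvolutiveWord

open RevealGame

variable {α L : Type} [DecidableEq α]

/-- Proper labellings with a given label at the root. -/
def rootedLabellings (α : Type) {L : Type} [DecidableEq α] (a : L) : Set (List α → L) :=
  {x | x ∈ properLabellings α L ∧ x [] = a}

theorem finitelyClosed_rootedLabellings (a : L) : FinitelyClosed (rootedLabellings α a) := by
  classical
  refine fun y hy => ⟨⟨fun w => ?_, fun u j => ?_⟩, ?_⟩
  · obtain ⟨x, hx, h⟩ := hy {red w, w}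
    rw [← h (red w) (by simp), ← h w (by simp)]
    exact hx.1.1 w
  · obtain ⟨x, hx, h⟩ := hy {u ++ [j], u}
    rw [← h (u ++ [j]) (by simp), ← h u (by simp)]
    exact hx.1.2 u j
  · obtain ⟨x, hx, h⟩ := hy {[]}
    rw [← h [] (by simp)]
    exact hx.2

theorem eq_root {a : L} {x : List α → L} (hx : x ∈ rootedLabellings α a) {w : List α}
    (hw : red w = []) : x w = a := by
  rw [eq_of_red_eq hx.1 (hw.trans red_nil.symm), hx.2]

/-- The words whose labels are revealed at stage `m` of the game in direction `i`: those in the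
direction `i` are revealed one half-step before the others of the same length. -/
def revealed (i : α) (m : ℕ) : Set (List α) :=
  {w | 2 * (red w).length ≤ m ∨ 2 * (red w).length ≤ m + 1 ∧ (red w).head? = some i}

theorem monotone_revealed (i : α) : Monotone (revealed i) := by
  rintro m n hmn w (h | ⟨h, h'⟩)
  · exact Or.inl (h.trans hmn)
  · exact Or.inr ⟨h.trans (by omega), h'⟩

theorem exists_mem_revealed (i : α) (w : List α) : ∃ m, w ∈ revealed i m := ⟨_, Or.inl le_rfl⟩

theorem eq_on_revealed_zero {a : L} (i : α) : ∀ x ∈ rootedLabellings α a,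
    ∀ y ∈ rootedLabellings α a, ∀ w ∈ revealed i 0, x w = y w := by
  intro x hx y hy w hw
  have : red w = [] := List.eq_nil_of_length_eq_zero (by rcases hw with h | ⟨h, -⟩ <;> omega)
  rw [eq_root hx this, eq_root hy this]

/-- Glue labellings along the directions at the root. -/
def glue (a : L) (z : α → List α → L) : List α → L := fun w =>
  match (red w).head? with
  | none => a
  | some i => z i w

theorem glue_apply {a : L} {z : α → List α → L} (hz : ∀ i, z i ∈ rootedLabellings α a) {i : α}
    {w : List α} (h : red w = [] ∨ (red w).head? = some i) : glue a z w = z i w := by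
  rcases h with h | h
  · simp [glue, h, eq_root (hz i) h]
  · simp [glue, h]

theorem glue_mem {a : L} {z : α → List α → L} (hz : ∀ i, z i ∈ rootedLabellings α a) :
    glue a z ∈ rootedLabellings α a := by
  refine ⟨⟨fun w => ?_, fun u j => ?_⟩, rfl⟩
  · unfold glue
    rw [red_red]
    cases (red w).head? with
    | none => rfl
    | some i => exact (hz i).1.1 w
  · obtain ⟨i, h, h'⟩ := exists_head u j
    rw [glue_apply hz h, glue_apply hz h']
    exact (hz i).1.2 u j

theorem exists_consistent [Nonempty α] {a : L} (ha : (rootedLabellings α a).Nonempty)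
    {σ : α → ℕ → (List α → L) → List α → L}
    (hσ : ∀ i, IsResponse (rootedLabellings α a) (revealed i) (σ i)) :
    ∃ x ∈ rootedLabellings α a, ∀ i, Consistent (revealed i) (σ i) 0 x := by
  obtain ⟨x₀, hx₀⟩ := ha
  let x : ℕ → List α → L := fun k =>
    k.rec x₀ fun k y => glue a fun i => σ i (2 * k) y
  have hx : ∀ k, x k ∈ rootedLabellings α a := fun k => by
    induction k with
    | zero => exact hx₀
    | succ k ih => exact glue_mem fun i => (hσ i).mem _ _ ih
  have hstep : ∀ k i w, (red w = [] ∨ (red w).head? = some i) →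
      x (k + 1) w = σ i (2 * k) (x k) w := fun k i w h =>
    glue_apply (fun i => (hσ i).mem _ _ (hx k)) h
  have hagree : ∀ k, ∀ w ∈ {w : List α | (red w).length ≤ k}, x (k + 1) w = x k w := by
    intro k w hw
    obtain ⟨i, hi⟩ : ∃ i, red w = [] ∨ (red w).head? = some i := by
      cases red w with
      | nil => exact ⟨Classical.arbitrary α, Or.inl rfl⟩
      | cons i t => exact ⟨i, Or.inr rfl⟩
    rw [hstep k i w hi]
    exact (hσ i).agree _ _ (hx k) _ (Or.inl (Nat.mul_le_mul_left 2 hw))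
  obtain ⟨y, hy, hyx⟩ := (finitelyClosed_rootedLabellings a).exists_limit
    (E := fun k => {w | (red w).length ≤ k}) (fun j k hjk w hw => le_trans hw hjk)
    (fun w => ⟨(red w).length, Nat.le_refl _⟩) hx hagree
  refine ⟨y, hy, fun i n hn w hw => ?_⟩
  obtain ⟨k, rfl⟩ : ∃ k, n = 2 * k := ⟨n / 2, by omega⟩
  have hyk : σ i (2 * k) y = σ i (2 * k) (x k) := by
    refine (hσ i).congr _ _ hy _ (hx k) fun v hv => hyx k v ?_
    show (red v).length ≤ k
    rcases hv with h | ⟨h, -⟩ <;> omega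
  rw [hyk]
  by_cases hk : (red w).length ≤ k
  · rw [hyx k w hk]
    exact ((hσ i).agree _ _ (hx k) _ (Or.inl (Nat.mul_le_mul_left 2 hk))).symm
  · obtain ⟨h1, h2⟩ : 2 * (red w).length ≤ 2 * k + 1 + 1 ∧ (red w).head? = some i := by
      rcases hw with h | h
      · omega
      · exact h
    rw [hyx (k + 1) w (show (red w).length ≤ k + 1 by omega), hstep k i w (Or.inr h2)]

/-- Glue the part of `x` away from the edge `i` at the root with a translate of the similar part
of `y`. -/
def join (i : α) (x y : List α → L) : List α → L := fun w =>
  if (red w).head? = some i then y (i :: w) else x w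

theorem head_push (i : α) {w : List α} (hw : IsRed w) :
    (push i w).head? = some i ↔ w.head? ≠ some i := by
  cases w with
  | nil => simp [push]
  | cons j t =>
    by_cases hij : i = j
    · subst hij
      cases t with
      | nil => simp [push]
      | cons k t =>
        have := (List.isChain_cons_cons.1 hw).1
        simpa [push] using this.symm
    · simp [push, hij, Ne.symm hij]

theorem head_red_cons (i : α) (w : List α) :
    (red (i :: w)).head? = some i ↔ (red w).head? ≠ some i := head_push i (isRed_red w)

theorem act_join (i : α) {x y : List α → L} (hy : y ∈ properLabellings α L) :
    act [i] (join i x y) = join i y x := by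
  funext w
  show join i x y (i :: w) = _
  unfold join
  simp only [head_red_cons]
  by_cases h : (red w).head? = some i
  · simp [h]
  · simp only [h, ne_eq, not_false_eq_true, if_true, if_false]
    exact eq_of_red_eq hy (red_cons_cons i w)

theorem join_mem (i : α) {a b : L} (hab : a ≠ b) {x y : List α → L}
    (hx : x ∈ rootedLabellings α a) (hy : y ∈ rootedLabellings α b) :
    join i x y ∈ rootedLabellings α a := by
  have hb : ∀ w : List α, red w = [i] → y (i :: w) = b := fun w hw =>
    eq_root hy (by rw [red_cons, hw]; simp [push])
  refine ⟨⟨fun w => ?_, fun u j => ?_⟩, by simp [join, hx.2]⟩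
  · unfold join
    rw [red_red]
    split_ifs
    · exact eq_of_red_eq hy.1 (red_append_congr [i] (red_red w))
    · exact hx.1.1 w
  · have h1 : red u = red (u ++ [j] ++ [j]) := by
      rw [List.append_assoc, List.singleton_append, red_append_cons_cons, List.append_nil]
    have h2 : ∀ v w : List α, red v = [] → red w = red (v ++ [j]) → red w = [j] := by
      intro v w hv hw
      rw [hw, red_append_congr_left [j] (hv.trans red_nil.symm)]
      rfl
    obtain ⟨i', h, h'⟩ := exists_head u j
    unfold join
    split_ifs with hu hv hv
    · exact hy.1.2 (i :: u) j
    · have hu' : red u = [] := by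
        rcases h with h | h
        · exact h
        · rcases h' with h' | h'
          · rw [h'] at hu; simp at hu
          · rw [hu] at h'; rw [← h'] at h; exact absurd h hv
      have h3 := h2 u _ hu' rfl
      obtain rfl : j = i := by rw [h3] at hu; simpa using hu
      rw [hb _ h3, eq_root hx hu']
      exact hab.symm
    · have hu' : red (u ++ [j]) = [] := by
        rcases h' with h' | h'
        · exact h'
        · rcases h with h | h
          · rw [h] at hv; simp at hv
          · rw [hv] at h; rw [← h] at h'; exact absurd h' hu
      have h3 := h2 _ u hu' h1
      obtain rfl : j = i := by rw [h3] at hv; simpa using hv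
      rw [hb _ h3, eq_root hx hu']
      exact hab
    · exact hx.1.2 u j

theorem length_push (i : α) {w : List α} :
    (w.head? = some i ∧ (push i w).length + 1 = w.length) ∨
      (w.head? ≠ some i ∧ (push i w).length = w.length + 1) := by
  cases w with
  | nil => simp [push]
  | cons j t =>
    by_cases hij : i = j
    · simp [push, hij]
    · simp [push, hij, Ne.symm hij]

theorem cons_mem_revealed (i : α) (k : ℕ) {w : List α} (hw : w ∈ revealed i (2 * k + 1)) :
    i :: w ∈ revealed i (2 * k + 1) := by
  have h1 := head_red_cons i w
  have h2 := length_push i (w := red w)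
  rw [← red_cons] at h2
  rcases h2 with ⟨h2, h3⟩ | ⟨h2, h3⟩
  · left
    rcases hw with hw | ⟨hw, -⟩ <;> omega
  · right
    refine ⟨?_, h1.2 h2⟩
    rcases hw with hw | ⟨-, hw⟩
    · omega
    · exact absurd hw h2

section Join

variable {a b : L} {σ τ : ℕ → (List α → L) → List α → L} {i : α} {x : List α → L} {k : ℕ}
  (hσ : IsResponse (rootedLabellings α a) (revealed i) σ)
  (hτ : IsResponse (rootedLabellings α b) (revealed i) τ)
  (hx : x ∈ rootedLabellings α a) (hx' : act [i] x ∈ rootedLabellings α b)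

include hσ hτ hx hx'

theorem join_agree : ∀ w ∈ revealed i (2 * k + 1),
    join i (σ (2 * k + 1) x) (τ (2 * k + 1) (act [i] x)) w = x w := by
  intro w hw
  unfold join
  split_ifs
  · rw [hτ.agree _ _ hx' _ (cons_mem_revealed i k hw)]
    exact eq_of_red_eq hx.1 (red_cons_cons i w)
  · exact hσ.agree _ _ hx _ hw

theorem join_eq {w : List α} (hw : (red w).length ≤ k + 1) :
    join i (σ (2 * k + 1) x) (τ (2 * k + 1) (act [i] x)) w = σ (2 * k + 1) x w := by
  by_cases h : (red w).head? = some i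
  · have : w ∈ revealed i (2 * k + 1) := Or.inr ⟨by omega, h⟩
    rw [join_agree hσ hτ hx hx' w this, hσ.agree _ _ hx _ this]
  · exact if_neg h

end Join

/-- A labelling whose label alternates between `a` and `b`. -/
theorem exists_rooted (i : α) {a b : L} (hab : a ≠ b) :
    ∃ x ∈ rootedLabellings α a, act [i] x ∈ rootedLabellings α b := by
  have hx : (fun w : List α => if w.length % 2 = 0 then a else b) ∈ properLabellings α L := by
    refine ⟨fun w => by simp only [length_red_mod_two], fun u j => ?_⟩
    simp only [List.length_append, List.length_singleton]
    rcases Nat.mod_two_eq_zero_or_one u.length with h | h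
    · simp [h, Nat.add_mod, hab.symm]
    · simp [h, Nat.add_mod, hab]
  exact ⟨_, ⟨hx, by simp⟩, act_mem hx _, by simp [act]⟩

theorem exists_consistent_pair {a b : L} (hab : a ≠ b) (i : α)
    {σ τ : ℕ → (List α → L) → List α → L}
    (hσ : IsResponse (rootedLabellings α a) (revealed i) σ)
    (hτ : IsResponse (rootedLabellings α b) (revealed i) τ) :
    ∃ x ∈ rootedLabellings α a, act [i] x ∈ rootedLabellings α b ∧
      Consistent (revealed i) σ 1 x ∧ Consistent (revealed i) τ 1 (act [i] x) := by
  have : Nonempty α := ⟨i⟩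
  obtain ⟨x₀, hx₀, hx₀'⟩ := exists_rooted i hab
  let x : ℕ → List α → L := fun k =>
    k.rec x₀ fun k y => join i (σ (2 * k + 1) y) (τ (2 * k + 1) (act [i] y))
  have hx : ∀ k, x k ∈ rootedLabellings α a ∧ act [i] (x k) ∈ rootedLabellings α b := by
    intro k
    induction k with
    | zero => exact ⟨hx₀, hx₀'⟩
    | succ k ih =>
      have h1 := hσ.mem (2 * k + 1) _ ih.1
      have h2 := hτ.mem (2 * k + 1) _ ih.2
      refine ⟨join_mem i hab h1 h2, ?_⟩
      show act [i] (join i _ _) ∈ _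
      rw [act_join i h2.1]
      exact join_mem i hab.symm h2 h1
  have hxs : ∀ k, act [i] (x (k + 1)) =
      join i (τ (2 * k + 1) (act [i] (x k))) (σ (2 * k + 1) (act [i] (act [i] (x k)))) := by
    intro k
    rw [act_act_self (hx k).1.1]
    exact act_join i (hτ.mem (2 * k + 1) _ (hx k).2).1
  obtain ⟨y, hy, hyx⟩ := (finitelyClosed_rootedLabellings a).exists_limit
    (E := fun k => revealed i (2 * k + 1))
    (fun j k hjk => monotone_revealed i (by omega))
    (fun w => ⟨(red w).length, Or.inl (by omega)⟩) (fun k => (hx k).1)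
    (fun k => join_agree hσ hτ (hx k).1 (hx k).2)
  have hyx' : ∀ k, ∀ w ∈ revealed i (2 * k + 1), act [i] y w = act [i] (x k) w :=
    fun k w hw => hyx k _ (cons_mem_revealed i k hw)
  have hy' : act [i] y ∈ rootedLabellings α b :=
    ⟨act_mem hy.1 _, by rw [hyx' 0 [] (Or.inl (by simp)), (hx 0).2.2]⟩
  have hmem : ∀ k (w : List α), w ∈ revealed i (2 * k + 1 + 1) → (red w).length ≤ k + 1 := by
    rintro k w (h | ⟨h, -⟩) <;> omega
  have hmem' : ∀ k (w : List α), w ∈ revealed i (2 * k + 1 + 1) →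
      w ∈ revealed i (2 * (k + 1) + 1) := fun k w hw => monotone_revealed i (by omega) hw
  refine ⟨y, hy, hy', fun n hn w hw => ?_, fun n hn w hw => ?_⟩ <;>
  obtain ⟨k, rfl⟩ : ∃ k, n = 2 * k + 1 := ⟨n / 2, by omega⟩
  · rw [hyx (k + 1) w (hmem' k w hw), hσ.congr _ _ hy _ (hx k).1 (hyx k)]
    exact join_eq hσ hτ (hx k).1 (hx k).2 (hmem k w hw)
  · rw [hyx' (k + 1) w (hmem' k w hw), hτ.congr _ _ hy' _ (hx k).2 (hyx' k), hxs]
    refine join_eq hτ hσ (hx k).2 ?_ (hmem k w hw)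
    rw [act_act_self (hx k).1.1]
    exact (hx k).1

/-- When there are more labels than directions, a Borel choice of a direction for every proper
labelling takes the same value at the two ends of some edge, in the direction of that edge. -/
theorem exists_conflict [Nonempty α] [Finite α] [Finite L] [MeasurableSpace L]
    [MeasurableSingletonClass L] (hcard : Nat.card α < Nat.card L)
    {P : (List α → L) → α → Prop} (hP : ∀ i, MeasurableSet {x | P x i})
    (hex : ∀ x ∈ properLabellings α L, ∃ i, P x i) :
    ∃ x ∈ properLabellings α L, ∃ i, P x i ∧ P (act [i] x) i := by
  have hcard' : 1 < Nat.card L := lt_of_le_of_lt Nat.card_pos hcard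
  have : Nontrivial L := (Finite.one_lt_card_iff_nontrivial).1 hcard'
  have : Inhabited L := Classical.inhabited_of_nonempty inferInstance
  have hwin : ∀ a : L, ∃ i : α, ∃ σ, IsResponse (rootedLabellings α a) (revealed i) σ ∧
      ∀ x ∈ rootedLabellings α a, Consistent (revealed i) σ 1 x → P x i := by
    intro a
    by_contra! hcon
    have h : ∀ i : α, ∃ σ, IsResponse (rootedLabellings α a) (revealed i) σ ∧
        ∀ x ∈ rootedLabellings α a, Consistent (revealed i) σ 0 x → ¬ P x i := by
      intro i
      refine (determined (monotone_revealed i) (exists_mem_revealed i) (eq_on_revealed_zero i)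
        (hP i).compl).resolve_right ?_
      rintro ⟨σ, hσ, hσ'⟩
      obtain ⟨x, hx, hx', hx''⟩ := hcon i σ hσ
      exact hσ' x hx hx' hx''
    choose σ hσ hσ' using h
    obtain ⟨b, hb⟩ := exists_ne a
    obtain ⟨x₀, hx₀, -⟩ := exists_rooted (Classical.arbitrary α) hb.symm
    obtain ⟨x, hx, hx'⟩ := exists_consistent ⟨x₀, hx₀⟩ hσ
    obtain ⟨i, hi⟩ := hex x hx.1
    exact hσ' i x hx (hx' i) hi
  choose i σ hσ hσ' using hwin
  obtain ⟨a, b, hab, hi⟩ : ∃ a b, a ≠ b ∧ i a = i b := by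
    have : ¬ Function.Injective i := fun h => by
      have := Nat.card_le_card_of_injective i h
      omega
    simpa [Function.Injective, and_comm] using this
  obtain ⟨x, hx, hx', hc, hc'⟩ := exists_consistent_pair hab (i a) (hσ a)
    (τ := σ b) (by rw [hi]; exact hσ b)
  refine ⟨x, hx.1, i a, hσ' a x hx hc, ?_⟩
  rw [hi] at hx' hc' ⊢
  exact hσ' b _ hx' hc'

end InvolutiveWord

/-! ### The free part -/

namespace InvolutiveWord

variable {α L : Type}

/-- The labels of `x` read along the path following the letters of `g` from index `p` on are those
of `g`, and `g` is a sequence of letters without backtracking. -/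
def OnPath (g : ℕ → α × L) (p : ℕ) (x : List α → L) : Prop :=
  (∀ q, (g q).1 ≠ (g (q + 1)).1) ∧
    ∀ k, x ((List.range' p k).map fun q => (g q).1) = (g (p + k)).2

theorem OnPath.succ {g : ℕ → α × L} {p : ℕ} {x : List α → L} (h : OnPath g p x) :
    OnPath g (p + 1) (act [(g p).1] x) := by
  refine ⟨h.1, fun k => ?_⟩
  have := h.2 (k + 1)
  rw [List.range'_succ] at this
  exact this.trans (by rw [add_right_comm, add_assoc])

theorem OnPath.root {g : ℕ → α × L} {p : ℕ} {x : List α → L} (h : OnPath g p x) :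
    x [] = (g p).2 := h.2 0

/-- Some labelling in the orbit of `x` follows `g`. -/
def Hits (g : ℕ → α × L) (x : List α → L) : Prop := ∃ v p, OnPath g p (act v x)

/-- A choice of the direction towards, and then along, the path `g`. -/
def PathRule (g : ℕ → α × L) (x : List α → L) (i : α) : Prop :=
  (∃ p, OnPath g p x ∧ (∀ q, q < p → ¬ OnPath g q x) ∧ (g p).1 = i) ∨
    ∃ u : List α, (∃ p, OnPath g p (act (i :: u) x)) ∧
      ∀ v : List α, v.length ≤ u.length → ¬ ∃ p, OnPath g p (act v x)

theorem Hits.exists_pathRule {g : ℕ → α × L} {x : List α → L} (h : Hits g x) :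
    ∃ i, PathRule g x i := by
  classical
  have h' : ∃ n, ∃ v : List α, v.length = n ∧ ∃ p, OnPath g p (act v x) :=
    let ⟨v, hv⟩ := h
    ⟨_, v, rfl, hv⟩
  obtain ⟨v, hv, hp⟩ := Nat.find_spec h'
  cases v with
  | nil =>
    exact ⟨_, Or.inl ⟨Nat.find hp, Nat.find_spec hp, fun q hq => Nat.find_min hp hq, rfl⟩⟩
  | cons i u =>
    refine ⟨i, Or.inr ⟨u, hp, fun w hw hw' => Nat.find_min h' ?_ ⟨w, rfl, hw'⟩⟩⟩
    rw [← hv]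
    simpa [Nat.lt_succ_iff] using hw

section Measurability

variable [MeasurableSpace L]

theorem measurable_act (w : List α) : Measurable (act w : (List α → L) → List α → L) :=
  measurable_pi_lambda _ fun v => measurable_pi_apply (w ++ v)

variable [MeasurableSingletonClass L]

theorem measurable_onPath (g : ℕ → α × L) (p : ℕ) : Measurable (OnPath g p) :=
  measurable_const.and <| Measurable.forall fun _ =>
    measurableSet_setOfPred.1 (measurable_pi_apply _ (measurableSet_singleton _))

variable [Countable α]

theorem measurable_hits (g : ℕ → α × L) : Measurable (Hits g) :=
  Measurable.exists fun v => Measurable.exists fun p =>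
    (measurable_onPath g p).comp (measurable_act v)

theorem measurable_pathRule (g : ℕ → α × L) (i : α) : Measurable fun x => PathRule g x i := by
  have h : ∀ v : List α, Measurable fun x : List α → L => ∃ p, OnPath g p (act v x) := fun v =>
    Measurable.exists fun p => (measurable_onPath g p).comp (measurable_act v)
  refine Measurable.or (Measurable.exists fun p => ?_) (Measurable.exists fun u => ?_)
  · exact (measurable_onPath g p).and <| Measurable.and
      (Measurable.forall fun q => measurable_const.imp (measurable_onPath g q).not)
      measurable_const
  · exact (h _).and <| Measurable.forall fun v => measurable_const.imp (h v).not

end Measurability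

theorem exists_enum_periodic (β : Type) [Finite β] [Nonempty β] : ∃ e : ℕ → ℕ → β,
    ∀ (g : ℕ → β) (n : ℕ), 0 < n → Function.Periodic g n → ∃ k, e k = g := by
  obtain ⟨e, he⟩ := exists_surjective_nat (Σ n : ℕ, Fin (n + 1) → β)
  refine ⟨fun k p => (e k).2 ⟨p % ((e k).1 + 1), Nat.mod_lt _ (Nat.succ_pos _)⟩, ?_⟩
  intro g n hn hg
  obtain ⟨n, rfl⟩ := Nat.exists_eq_succ_of_ne_zero hn.ne'
  obtain ⟨k, hk⟩ := he ⟨n, fun r => g r⟩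
  refine ⟨k, ?_⟩
  dsimp only
  rw [hk]
  exact funext fun p => hg.map_mod_nat p

variable [DecidableEq α]

section Proper

variable {x : List α → L} (hx : x ∈ properLabellings α L)

include hx

theorem hits_act (g : ℕ → α × L) (i : α) : Hits g (act [i] x) ↔ Hits g x := by
  constructor
  · rintro ⟨v, h⟩
    exact ⟨i :: v, by rwa [act_act] at h⟩
  · rintro ⟨v, h⟩
    exact ⟨i :: v, by rwa [act_cons_act hx]⟩

theorem not_pathRule_act {g : ℕ → α × L} {i : α} (h : PathRule g x i) :
    ¬ PathRule g (act [i] x) i := by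
  intro h'
  rcases h with ⟨p, hp, hp', hpi⟩ | ⟨u, hu, hu'⟩ <;> rcases h' with ⟨q, hq, hq', hqi⟩ | ⟨v, hv, hv'⟩
  · have h1 : q ≤ p + 1 := not_lt.1 fun hlt => hq' _ hlt (hpi ▸ hp.succ)
    have h2 : p ≤ q + 1 := not_lt.1 fun hlt => hp' _ hlt <| by
      have := hq.succ
      rwa [hqi, act_act_self hx] at this
    have h3 : p ≠ q := by
      rintro rfl
      exact hx.2 [] i (hq.root.trans hp.root.symm)
    rcases (show q = p + 1 ∨ p = q + 1 by omega) with rfl | rfl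
    · exact hp.1 p (hpi.trans hqi.symm)
    · exact hp.1 q (hqi.trans hpi.symm)
  · exact hv' [] (Nat.zero_le _) ⟨_, hpi ▸ hp.succ⟩
  · refine hu' [] (Nat.zero_le _) ⟨q + 1, ?_⟩
    have := hq.succ
    rwa [hqi, act_act_self hx] at this
  · rw [act_cons_act hx] at hv
    have h1 : u.length < v.length := not_le.1 fun h => hu' v h hv
    refine hv' u h1.le ?_
    rwa [act_act]

/-- A labelling with a nontrivial stabilizer hits a periodic path. -/
theorem exists_periodic_hits {w : List α} (hw : red w ≠ []) (hwx : act w x = x) :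
    ∃ g : ℕ → α × L, ∃ n, 0 < n ∧ Function.Periodic g n ∧ Hits g x := by
  classical
  have hex : ∃ n, ∃ v w : List α, IsRed w ∧ w ≠ [] ∧ act w (act v x) = act v x ∧ w.length = n :=
    ⟨_, [], red w, isRed_red w, hw, (act_congr hx (red_red w)).trans hwx, rfl⟩
  obtain ⟨v, w, hred, hne, hfix, hlen⟩ := Nat.find_spec hex
  have hmin : ∀ v' w' : List α, IsRed w' → w' ≠ [] → act w' (act v' x) = act v' x →
      w.length ≤ w'.length := fun v' w' h1 h2 h3 =>
    hlen ▸ Nat.find_min' hex ⟨v', w', h1, h2, h3, rfl⟩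
  have hy := act_mem hx v
  obtain ⟨i, t, j, rfl, hij⟩ : ∃ i t j, w = i :: (t ++ [j]) ∧ i ≠ j := by
    obtain ⟨i, s, rfl⟩ := List.exists_cons_of_ne_nil hne
    rcases List.eq_nil_or_concat s with rfl | ⟨t, j, rfl⟩
    · exact absurd (congrFun hfix []) (hy.2 [] i)
    · refine ⟨i, t, j, by simp, ?_⟩
      rintro rfl
      rw [List.concat_eq_append] at hred hfix hmin
      have h1 : act (i :: t) (act v x) = act [i] (act v x) := by
        have h2 : act [i] (act (i :: t) (act v x)) = act v x := by
          rw [act_act]; exact hfix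
        rw [← h2, act_act_self (act_mem hy _), h2]
      have h3 := hmin (v ++ [i]) t hred.tail.left_of_append ?_ ?_
      · simp at h3
      · rintro rfl
        exact (List.isChain_cons_cons.1 hred).1 rfl
      · rw [← act_act, act_act, ← h1]
        rfl
  set w := i :: (t ++ [j]) with hw'
  have hpos : 0 < w.length := by simp [hw']
  set y := act v x
  let G : ℕ → α := fun p => w[p % w.length]'(Nat.mod_lt _ hpos)
  have hG : ∀ p, G (w.length + p) = G p := fun p => by simp [G]
  have hGw : (List.range' 0 w.length).map G = w := by
    refine List.ext_getElem (by simp) fun k h1 h2 => ?_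
    simp [G, Nat.mod_eq_of_lt h2]
  have hGne : ∀ p, G p ≠ G (p + 1) := by
    intro p
    have hlt := Nat.mod_lt p hpos
    by_cases hp : p % w.length + 1 < w.length
    · have h1 : (p + 1) % w.length = p % w.length + 1 := by
        rw [Nat.add_mod, Nat.mod_eq_of_lt (a := 1) (by omega), Nat.mod_eq_of_lt hp]
      simp only [G, h1]
      exact List.isChain_iff_getElem.1 hred _ hp
    · have h1 : (p + 1) % w.length = 0 := by
        rw [Nat.add_mod_eq_ite]
        have h2 : w.length = t.length + 2 := by simp [hw']
        rw [Nat.mod_eq_of_lt (a := 1) (by omega), if_pos (by omega)]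
        omega
      have h2 : p % w.length = t.length + 1 := by
        have : w.length = t.length + 2 := by simp [hw']
        omega
      simp only [G, h1, h2]
      simpa [hw'] using hij.symm
  let l : ℕ → L := fun k => y ((List.range' 0 k).map G)
  have hl : ∀ k, l (w.length + k) = l k := by
    intro k
    have h1 : (List.range' 0 (w.length + k)).map G = w ++ (List.range' 0 k).map G := by
      rw [← List.range'_append_1, List.map_append, hGw, zero_add,
        show List.range' w.length k = List.range' (w.length + 0) k from rfl,
        ← List.map_add_range', List.map_map]
      congr 1
      exact List.map_congr_left fun p _ => hG p
    simp only [l, h1]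
    exact congrFun hfix _
  refine ⟨fun p => (G p, l p), w.length, hpos, fun p => ?_, v, 0, hGne, fun k => ?_⟩
  · show (G (p + w.length), l (p + w.length)) = (G p, l p)
    rw [add_comm, hG, hl]
  · simp only [zero_add]
    rfl

end Proper

/-- Proper labellings with trivial stabilizer. -/
def freeLabellings (α L : Type) [DecidableEq α] : Set (List α → L) :=
  {x | x ∈ properLabellings α L ∧ ∀ w, act w x = x → red w = []}

theorem act_mem_freeLabellings {x : List α → L} (hx : x ∈ freeLabellings α L) (w : List α) :
    act w x ∈ freeLabellings α L := by
  refine ⟨act_mem hx.1 w, fun v hv => ?_⟩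
  have h1 : act (w ++ (v ++ w.reverse)) x = x := by
    rw [← act_act, ← act_act v, hv, act_act, ← List.append_nil w.reverse]
    exact act_congr hx.1 (red_append_reverse_append w [])
  have h2 := hx.2 _ h1
  have h3 : red (w.reverse ++ (w ++ (v ++ w.reverse) ++ w)) = red v := by
    have := red_append_reverse_append w.reverse (v ++ (w.reverse ++ (w.reverse.reverse ++ [])))
    rw [List.reverse_reverse, red_append_congr v (v' := [])
      (by have := red_append_reverse_append w.reverse []; simpa using this)] at this
    simpa using this
  rw [← h3, red_append_congr w.reverse (v' := w)]
  · have := red_append_reverse_append w.reverse []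
    simpa using this
  · rw [red_append_congr_left w (h2.trans red_nil.symm)]
    rfl

theorem measurableSet_freeLabellings [Countable α] [Countable L] [MeasurableSpace L]
    [MeasurableSingletonClass L] : MeasurableSet (freeLabellings α L) := by
  have h : ∀ v w : List α, Measurable fun x : List α → L => x v = x w := fun v w =>
    measurableSet_setOfPred.1 (measurableSet_eq_fun (measurable_pi_apply v) (measurable_pi_apply w))
  have h1 : Measurable fun x : List α → L => x ∈ properLabellings α L :=
    (Measurable.forall fun w => h _ _).and <|
      Measurable.forall fun u => Measurable.forall fun j => (h _ _).not
  refine measurableSet_setOfPred.2 (h1.and <| Measurable.forall fun w => ?_)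
  simp only [funext_iff]
  exact (Measurable.forall fun v => h (w ++ v) v).imp measurable_const

/-- With more labels than letters, the tree graph on the free labellings has no Borel colouring by
the letters. -/
theorem exists_color_eq [Nonempty α] [Finite α] [MeasurableSpace α] [MeasurableSingletonClass α]
    [Finite L] [MeasurableSpace L] [MeasurableSingletonClass L] (hcard : Nat.card α < Nat.card L)
    {c : (List α → L) → α} (hc : Measurable c) :
    ∃ x ∈ freeLabellings α L, ∃ i, c (act [i] x) = c x := by
  have : Nonempty L := (Nat.card_pos_iff.1 (Nat.zero_lt_of_lt hcard)).1
  obtain ⟨e, he⟩ := exists_enum_periodic (α × L)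
  let P : (List α → L) → α → Prop := fun x i =>
    (∃ k, (Hits (e k) x ∧ ∀ k', k' < k → ¬ Hits (e k') x) ∧ PathRule (e k) x i) ∨
      (∀ k, ¬ Hits (e k) x) ∧ c x = i
  have hP : ∀ i, MeasurableSet {x | P x i} := by
    intro i
    refine measurableSet_setOfPred.2 (Measurable.or (Measurable.exists fun k => ?_) ?_)
    · exact ((measurable_hits (e k)).and <| Measurable.forall fun k' =>
        measurable_const.imp (measurable_hits (e k')).not).and (measurable_pathRule (e k) i)
    · exact (Measurable.forall fun k => (measurable_hits (e k)).not).and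
        (measurableSet_setOfPred.1 (hc (measurableSet_singleton i)))
  have hex : ∀ x ∈ properLabellings α L, ∃ i, P x i := by
    classical
    intro x _
    by_cases h : ∃ k, Hits (e k) x
    · obtain ⟨i, hi⟩ := (Nat.find_spec h).exists_pathRule
      exact ⟨i, Or.inl ⟨_, ⟨Nat.find_spec h, fun k' hk' => Nat.find_min h hk'⟩, hi⟩⟩
    · exact ⟨c x, Or.inr ⟨not_exists.1 h, rfl⟩⟩
  obtain ⟨x, hx, i, h, h'⟩ := exists_conflict hcard hP hex
  simp only [P, hits_act hx] at h h'
  rcases h with ⟨k, ⟨hk, hk'⟩, h⟩ | ⟨hno, h⟩ <;> rcases h' with ⟨q, ⟨hq, hq'⟩, h'⟩ | ⟨hno', h'⟩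
  · obtain rfl : k = q := by
      rcases lt_trichotomy k q with hlt | heq | hlt
      · exact absurd hk (hq' _ hlt)
      · exact heq
      · exact absurd hq (hk' _ hlt)
    exact absurd h' (not_pathRule_act hx h)
  · exact absurd hk (hno' k)
  · exact absurd hq (hno q)
  · refine ⟨x, ⟨hx, fun w hw => ?_⟩, i, h'.trans h.symm⟩
    by_contra hne
    obtain ⟨g, n, hn, hg, hit⟩ := exists_periodic_hits hx hne hw
    obtain ⟨k, rfl⟩ := he g n hn hg
    exact hno k hit

end InvolutiveWord

/-! ### Graphs of free involutions -/

namespace InvolutiveWord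

section Involution

variable {α Z : Type} {t : α → Z → Z}

theorem foldr_red [DecidableEq α] (ht : ∀ j z, t j (t j z) = z) (w : List α) (z : Z) :
    (red w).foldr t z = w.foldr t z := by
  have hpush : ∀ i (w : List α), (push i w).foldr t z = t i (w.foldr t z) := by
    intro i w
    cases w with
    | nil => rfl
    | cons j w =>
      by_cases hij : i = j
      · simp [push, hij, ht]
      · simp [push, hij]
  induction w with
  | nil => rfl
  | cons i w ih => rw [red_cons, hpush, ih]; rfl

/-- The graph joining every point to its images under a family of involutions without fixed
points. -/
def involutionGraph (ht : ∀ j z, t j (t j z) = z) (hne : ∀ j z, t j z ≠ z) : SimpleGraph Z where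
  Adj z z' := ∃ j, t j z = z'
  symm := ⟨by rintro z _ ⟨j, rfl⟩; exact ⟨j, ht j z⟩⟩
  loopless := ⟨by rintro z ⟨j, h⟩; exact hne j z h⟩

variable (ht : ∀ j z, t j (t j z) = z) (hne : ∀ j z, t j z ≠ z)
  (hfree : ∀ w : List α, IsRed w → w ≠ [] → ∀ z, w.foldr t z ≠ z)

include hfree

theorem encard_neighborSet (z : Z) :
    ((involutionGraph ht hne).neighborSet z).encard = ENat.card α := by
  have h : (involutionGraph ht hne).neighborSet z = (fun j => t j z) '' Set.univ := by
    ext z'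
    simp [SimpleGraph.mem_neighborSet, involutionGraph]
  have hinj : Function.Injective fun j => t j z := by
    intro j k hjk
    by_contra hne'
    refine hfree [j, k] (by simpa using hne') (by simp) z ?_
    show t j (t k z) = z
    rw [← show t j z = t k z from hjk, ht]
  rw [h, hinj.encard_image, Set.encard_univ]

theorem isAcyclic_involutionGraph : (involutionGraph ht hne).IsAcyclic := by
  have key : ∀ {u v} (p : (involutionGraph ht hne).Walk u v), p.IsTrail →
      ∃ w : List α, IsRed w ∧ w.foldr t v = u ∧ w.length = p.length ∧
        ∀ j ∈ w.head?, s(u, t j u) ∈ p.edges := by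
    intro u v p
    induction p with
    | nil => exact fun _ => ⟨[], List.isChain_nil, rfl, rfl, by simp⟩
    | @cons u u' v h p ih =>
      intro hp
      rw [SimpleGraph.Walk.isTrail_cons] at hp
      obtain ⟨w, hw, hw', hlen, hedge⟩ := ih hp.1
      obtain ⟨j, rfl⟩ := h
      refine ⟨j :: w, ?_, by simp [hw', ht], congrArg (· + 1) hlen, ?_⟩
      swap
      · rintro _ ⟨⟩
        exact List.mem_cons_self
      cases w with
      | nil => exact List.isChain_singleton _
      | cons k w =>
        refine List.isChain_cons_cons.2 ⟨?_, hw⟩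
        rintro rfl
        refine hp.2 ?_
        have := hedge j rfl
        rwa [ht, Sym2.eq_swap] at this
  intro v p hp
  obtain ⟨w, hw, hw', hlen, -⟩ := key p hp.isTrail
  refine hfree w hw ?_ v hw'
  rintro rfl
  have := hp.three_le_length
  simp at hlen
  omega

end Involution

/-! ### Induced spaces -/

/-- All sets of words are measurable. -/
local instance wordMeasurableSpace {δ : Type} : MeasurableSpace (List δ) := ⊤

local instance {δ : Type} : DiscreteMeasurableSpace (List δ) := ⟨fun _ => trivial⟩

variable {β γ L : Type}

/-- The reduced words representing the cosets of the words in the letters from `β`. -/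
def IsRep (l : List (β ⊕ γ)) : Prop := IsRed l ∧ ∀ i, l.getLast? ≠ some (Sum.inl i)

theorem isRep_nil : IsRep ([] : List (β ⊕ γ)) := ⟨List.isChain_nil, by simp⟩

theorem IsRep.tail {j : β ⊕ γ} {l : List (β ⊕ γ)} (h : IsRep (j :: l)) : IsRep l := by
  refine ⟨h.1.tail, fun i hi => h.2 i ?_⟩
  rw [List.getLast?_cons, hi]
  rfl

theorem exists_append_map_inl {w : List (β ⊕ γ)} (hw : IsRed w) :
    ∃ (l : List (β ⊕ γ)) (b : List β), w = l ++ b.map Sum.inl ∧ IsRep l := by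
  induction w using List.reverseRecOn with
  | nil => exact ⟨[], [], rfl, isRep_nil⟩
  | append_singleton w j ih =>
    rcases j with i | k
    · obtain ⟨l, b, h, hl⟩ := ih hw.left_of_append
      exact ⟨l, b ++ [i], by simp [h], hl⟩
    · exact ⟨w ++ [Sum.inr k], [], by simp, hw, by simp⟩

theorem isRed_of_map_inl {b : List β} (h : IsRed (b.map (Sum.inl (β := γ)))) : IsRed b := by
  rw [IsRed, List.isChain_map] at h
  exact h.imp fun i j hij h' => hij (congrArg _ h')

variable [DecidableEq β]

variable (β γ L) in
/-- The space induced from the free labellings. -/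
def induced : Set ((List β → L) × List (β ⊕ γ)) :=
  {z | z.1 ∈ freeLabellings β L ∧ IsRep z.2}

theorem measurableSet_induced [Countable β] [Countable L] [MeasurableSpace L]
    [MeasurableSingletonClass L] : MeasurableSet (induced β γ L) :=
  (measurable_fst measurableSet_freeLabellings).inter
    (measurable_snd (MeasurableSet.of_discrete (s := {l | IsRep l})))

variable [DecidableEq γ]

/-- The action of the letters on the pairs of a labelling and a coset representative. -/
def step (j : β ⊕ γ) (z : (List β → L) × List (β ⊕ γ)) : (List β → L) × List (β ⊕ γ) :=
  match j, z with
  | Sum.inl i, (x, []) => (act [i] x, [])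
  | j, (x, l) => (x, push j l)

theorem step_inl (i : β) (x : List β → L) :
    step (γ := γ) (Sum.inl i) (x, []) = (act [i] x, []) := rfl

theorem step_of_ne {j : β ⊕ γ} {l : List (β ⊕ γ)} (h : l = [] → ∀ i, j ≠ Sum.inl i)
    (x : List β → L) : step j (x, l) = (x, push j l) := by
  rcases j with i | k <;> rcases l with _ | ⟨j', l⟩
  · exact absurd rfl (h rfl i)
  · rfl
  · rfl
  · rfl

theorem IsRep.push {j : β ⊕ γ} {l : List (β ⊕ γ)} (hl : IsRep l)
    (h : l = [] → ∀ i, j ≠ Sum.inl i) : IsRep (push j l) := by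
  cases l with
  | nil => exact ⟨List.isChain_singleton _, by simpa [InvolutiveWord.push] using h rfl⟩
  | cons k l =>
    by_cases hjk : j = k
    · simpa [InvolutiveWord.push, hjk] using hl.tail
    · refine ⟨hl.1.push, ?_⟩
      simpa [InvolutiveWord.push, hjk, List.getLast?_cons] using hl.2

theorem step_mem_step_step {z : (List β → L) × List (β ⊕ γ)} (hz : z ∈ induced β γ L)
    (j : β ⊕ γ) : step j z ∈ induced β γ L ∧ step j (step j z) = z := by
  obtain ⟨x, l⟩ := z
  by_cases h : l = [] → ∀ i, j ≠ Sum.inl i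
  · rw [step_of_ne h]
    refine ⟨⟨hz.1, hz.2.push h⟩, ?_⟩
    rw [step_of_ne, push_push hz.2.1]
    intro hl i hj
    have hl' : l = [j] := by
      rw [← push_push (i := j) (w := l) hz.2.1, hl]
      rfl
    exact hz.2.2 i (by simp [hl', hj])
  · push Not at h
    obtain ⟨rfl, i, rfl⟩ := h
    rw [step_inl]
    exact ⟨⟨act_mem_freeLabellings hz.1 _, hz.2⟩, by rw [step_inl, act_act_self hz.1.1]⟩

theorem foldr_step_of_isRep (x : List β → L) {l : List (β ⊕ γ)} (hl : IsRep l) :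
    l.foldr step (x, []) = (x, l) := by
  induction l with
  | nil => rfl
  | cons j l ih =>
    rw [List.foldr_cons, ih hl.tail, step_of_ne, push_of_isRed hl.1]
    rintro rfl i rfl
    exact hl.2 i rfl

theorem foldr_step_map_inl (b : List β) (x : List β → L) :
    (b.map (Sum.inl (β := γ))).foldr step (x, []) = (act b.reverse x, []) := by
  induction b with
  | nil => rfl
  | cons i b ih =>
    rw [List.map_cons, List.foldr_cons, ih, step_inl, act_act, List.reverse_cons]

/-- The letters, as involutions of the induced space. -/
def move (j : β ⊕ γ) (z : induced β γ L) : induced β γ L :=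
  ⟨step j z.1, (step_mem_step_step z.2 j).1⟩

theorem move_move (j : β ⊕ γ) (z : induced β γ L) : move j (move j z) = z :=
  Subtype.ext (step_mem_step_step z.2 j).2

theorem coe_foldr_move (w : List (β ⊕ γ)) (z : induced β γ L) :
    (w.foldr move z).1 = w.foldr step z.1 := by
  induction w with
  | nil => rfl
  | cons j w ih => rw [List.foldr_cons, List.foldr_cons, ← ih]; rfl

theorem foldr_move_ne {w : List (β ⊕ γ)} (hw : IsRed w) (hne : w ≠ []) (z : induced β γ L) :
    w.foldr move z ≠ z := by
  obtain ⟨⟨x, l⟩, hx, hl⟩ := z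
  intro h
  let z₀ : induced β γ L := ⟨(x, []), hx, isRep_nil⟩
  have hz : l.foldr move z₀ = ⟨(x, l), hx, hl⟩ :=
    Subtype.ext ((coe_foldr_move l z₀).trans (foldr_step_of_isRep x hl))
  rw [← hz, ← List.foldr_append, ← foldr_red move_move, hz] at h
  obtain ⟨l', b, hlb, hl'⟩ := exists_append_map_inl (isRed_red (w ++ l))
  have h1 := (coe_foldr_move (red (w ++ l)) z₀).symm.trans (congrArg Subtype.val h)
  change (red (w ++ l)).foldr step (x, []) = (x, l) at h1
  rw [hlb, List.foldr_append, foldr_step_map_inl, foldr_step_of_isRep _ hl', Prod.mk.injEq] at h1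
  have hb : b = [] := by
    have h2 : IsRed (b.map (Sum.inl (β := γ))) := by
      have := isRed_red (w ++ l)
      rw [hlb] at this
      exact this.right_of_append
    have h3 : red b.reverse = [] := hx.2 _ h1.1
    have h4 := red_append_reverse_append b []
    rw [List.append_nil, red_append_congr b (h3.trans red_nil.symm), List.append_nil,
      red_of_isRed (isRed_of_map_inl h2)] at h4
    exact h4
  rw [hb, List.map_nil, List.append_nil, h1.2] at hlb
  have h5 : red w = [] := by
    have h6 := red_append_congr_left l.reverse (hlb.trans (red_of_isRed hl.1).symm)
    have h7 := red_append_reverse_append l []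
    rw [List.append_nil] at h7
    rw [h7, List.append_assoc, red_append_congr w (h7.trans red_nil.symm),
      List.append_nil] at h6
    exact h6
  rw [red_of_isRed hw] at h5
  exact hne h5

variable (β γ L) in
/-- The graph of the letters on the induced space. -/
def inducedGraph : SimpleGraph (induced β γ L) :=
  involutionGraph (t := move) move_move fun j z =>
    foldr_move_ne (w := [j]) (List.isChain_singleton j) (List.cons_ne_nil _ _) z

section Measurability

variable [Countable β] [Countable γ] [MeasurableSpace L]

theorem measurable_step (j : β ⊕ γ) :
    Measurable (step j : (List β → L) × List (β ⊕ γ) → (List β → L) × List (β ⊕ γ)) := by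
  refine measurable_from_prod_countable_left fun l => ?_
  by_cases h : l = [] → ∀ i, j ≠ Sum.inl i
  · simp only [step_of_ne h]
    exact measurable_id.prodMk measurable_const
  · push Not at h
    obtain ⟨rfl, i, rfl⟩ := h
    exact (measurable_act [i]).prodMk measurable_const

theorem measurableSet_inducedGraph [Countable L] [DiscreteMeasurableSpace L] :
    MeasurableSet {p : induced β γ L × induced β γ L | (inducedGraph β γ L).Adj p.1 p.2} := by
  have h : {p : induced β γ L × induced β γ L | (inducedGraph β γ L).Adj p.1 p.2} =
      ⋃ j, {p | step j p.1.1 = p.2.1} := by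
    ext p
    simp [inducedGraph, involutionGraph, move, Subtype.ext_iff]
  rw [h]
  exact MeasurableSet.iUnion fun j => measurableSet_eq_fun
    ((measurable_step j).comp (measurable_subtype_coe.comp measurable_fst))
    (measurable_subtype_coe.comp measurable_snd)

/-- The colouring of the induced space by the root label, modified at odd distance. -/
theorem exists_measurable_coloring {f : L → L} (hf : Measurable f) (hf' : ∀ a, f a ≠ a) :
    ∃ c : induced β γ L → L, Measurable c ∧
      ∀ z z', (inducedGraph β γ L).Adj z z' → c z ≠ c z' := by
  let c : (List β → L) × List (β ⊕ γ) → L := fun z =>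
    if z.2.length % 2 = 0 then z.1 [] else f (z.1 [])
  refine ⟨fun z => c z.1, ?_, ?_⟩
  · refine Measurable.comp (g := c) (measurable_from_prod_countable_left fun l => ?_)
      measurable_subtype_coe
    by_cases h : l.length % 2 = 0
    · simpa [c, h] using measurable_pi_apply []
    · simpa [c, h, Function.comp_def] using
        hf.comp (measurable_pi_apply (X := fun _ : List β => L) [])
  · rintro ⟨⟨x, l⟩, hx, hl⟩ _ ⟨j, rfl⟩
    show c (x, l) ≠ c (step j (x, l))
    by_cases h : l = [] → ∀ i, j ≠ Sum.inl i
    · rw [step_of_ne h]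
      have hlen := length_push_mod_two j l
      rcases Nat.mod_two_eq_zero_or_one l.length with h' | h'
      · have h2 : (push j l).length % 2 = 1 := by omega
        simpa [c, h', h2] using (hf' _).symm
      · have h2 : (push j l).length % 2 = 0 := by omega
        simpa [c, h', h2] using hf' _
    · push Not at h
      obtain ⟨rfl, i, rfl⟩ := h
      exact (hx.1.2 [] i).symm

end Measurability

/-- The graph on the induced space has no Borel colouring by the letters from `β`. -/
theorem exists_adj_color_eq [Nonempty β] [Finite β] [Finite L] [MeasurableSpace L]
    [MeasurableSingletonClass L] [MeasurableSpace β] [DiscreteMeasurableSpace β]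
    (hcard : Nat.card β < Nat.card L) {c : induced β γ L → β} (hc : Measurable c) :
    ∃ z z', (inducedGraph β γ L).Adj z z' ∧ c z = c z' := by
  classical
  let r : freeLabellings β L → induced β γ L := fun x => ⟨(x.1, []), x.2, isRep_nil⟩
  have hr : Measurable r := (measurable_subtype_coe.prodMk measurable_const).subtype_mk
  obtain ⟨x, hx, i, h⟩ := exists_color_eq hcard ((hc.comp hr).dite
    (measurable_const (a := Classical.arbitrary β)) measurableSet_freeLabellings)
  rw [dif_pos hx, dif_pos (act_mem_freeLabellings hx [i])] at h
  exact ⟨r ⟨x, hx⟩, _, ⟨Sum.inl i, rfl⟩, h.symm⟩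

theorem borelChromaticNumber_inducedGraph [Countable γ] [Nonempty β] [Finite β] [Finite L]
    [MeasurableSpace L] [DiscreteMeasurableSpace L]
    (hcard : Nat.card L = Nat.card β + 1) {f : L → L} (hf : ∀ a, f a ≠ a) :
    borelChromaticNumber (inducedGraph β γ L).Adj = Nat.card L := by
  obtain ⟨c, hc, hc'⟩ := exists_measurable_coloring (β := β) (γ := γ) (f := f) .of_discrete hf
  have hmem : ((Nat.card L : ℕ) : Cardinal) ∈ {κ : Cardinal | ∃ (Y : Type) (mY : MeasurableSpace Y),
      @StandardBorelSpace Y mY ∧ Cardinal.mk Y = κ ∧ ∃ c : induced β γ L → Y,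
        @Measurable _ Y _ mY c ∧ ∀ x y, (inducedGraph β γ L).Adj x y → c x ≠ c y} :=
    ⟨L, inferInstance, inferInstance, (Nat.cast_card).symm, c, hc, hc'⟩
  refine le_antisymm (csInf_le' hmem) (le_csInf ⟨_, hmem⟩ ?_)
  rintro _ ⟨Y, mY, hY, rfl, c, hc, hc'⟩
  by_contra! hlt
  have : Finite Y := Cardinal.lt_aleph0_iff_finite.1 (hlt.trans (Cardinal.natCast_lt_aleph0))
  rw [← Nat.cast_card, Nat.cast_lt, hcard, Nat.lt_succ_iff] at hlt
  obtain ⟨g, hg⟩ : ∃ g : Y → β, Function.Injective g := by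
    have := Fintype.ofFinite Y
    have := Fintype.ofFinite β
    rw [Nat.card_eq_fintype_card, Nat.card_eq_fintype_card] at hlt
    obtain ⟨g⟩ := Function.Embedding.nonempty_of_card_le hlt
    exact ⟨g, g.injective⟩
  let _ : MeasurableSpace β := ⊤
  have : DiscreteMeasurableSpace β := ⟨fun _ => trivial⟩
  obtain ⟨z, z', hadj, h⟩ := exists_adj_color_eq (γ := γ) (L := L) (by omega)
    ((measurable_of_finite g).comp hc)
  exact hc' z z' hadj (hg h)

theorem isAcyclic_inducedGraph : (inducedGraph β γ L).IsAcyclic :=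
  isAcyclic_involutionGraph _ _ fun _ hw hne z => foldr_move_ne hw hne z

theorem encard_neighborSet_inducedGraph (z : induced β γ L) :
    ((inducedGraph β γ L).neighborSet z).encard = ENat.card (β ⊕ γ) :=
  encard_neighborSet _ _ (fun _ hw hne z => foldr_move_ne hw hne z) z

theorem exists_borel_graph (d k : ℕ) (hd : 0 < d) :
    ∃ (X : Type) (mX : MeasurableSpace X) (G : SimpleGraph X),
      @StandardBorelSpace X mX ∧
      @MeasurableSet (X × X) (@Prod.instMeasurableSpace X X mX mX)
        {p : X × X | G.Adj p.1 p.2} ∧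
      (∀ x, (G.neighborSet x).encard = (d + k : ℕ)) ∧
      G.IsAcyclic ∧
      @borelChromaticNumber X mX G.Adj = ((d + 1 : ℕ) : Cardinal) := by
  have : Nonempty (Fin d) := ⟨⟨0, hd⟩⟩
  have : NeZero d := ⟨hd.ne'⟩
  refine ⟨induced (Fin d) (Fin k) (Fin (d + 1)), inferInstance, inducedGraph _ _ _,
    measurableSet_induced.standardBorel, measurableSet_inducedGraph, fun z => ?_,
    isAcyclic_inducedGraph, ?_⟩
  · rw [encard_neighborSet_inducedGraph]
    simp
  · rw [borelChromaticNumber_inducedGraph (by simp) (f := fun a => a + 1) (by simp)]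
    simp

end InvolutiveWord

/-- For every `n ≥ 1` and every `m ∈ {2, …, n+1}`, there is an `n`-regular acyclic Borel
graph on a standard Borel space whose Borel chromatic number is exactly `m`. -/
theorem stmt_5 (n m : ℕ) (hn : 1 ≤ n) (hm2 : 2 ≤ m) (hmn : m ≤ n + 1) :
    ∃ (X : Type) (mX : MeasurableSpace X) (G : SimpleGraph X),
      @StandardBorelSpace X mX ∧
      @MeasurableSet (X × X) (@Prod.instMeasurableSpace X X mX mX)
        {p : X × X | G.Adj p.1 p.2} ∧
      (∀ x, (G.neighborSet x).encard = n) ∧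
      G.IsAcyclic ∧
      @borelChromaticNumber X mX G.Adj = (m : Cardinal) := by
  obtain ⟨d, rfl⟩ : ∃ d, m = d + 1 := ⟨m - 1, by omega⟩
  obtain ⟨k, rfl⟩ := Nat.exists_eq_add_of_le (Nat.succ_le_succ_iff.1 hmn)
  exact InvolutiveWord.exists_borel_graph d k (by omega)
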